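/- arXiv:2003.05270 — 2 statements merged into one kernel-verified Lean document; each statement's English description precedes it below -/
import Mathlib

section
/- Let S : F(a,b) → F(Δ) be a set of at least two homomorphisms from the free group of rank two, none of which is injective. Then Eq(S) is a nontrivial normal subgroup of F(a,b) of infinite index, and hence is not finitely generated. -/
theorem fg_resfin {α : Type} (w : FreeGroup α) (hw : w ≠ 1) :
    ∃ (Q : Type) (_ : Group Q) (_ : Finite Q) (ρ : FreeGroup α →* Q), ρ w ≠ 1 := by
  classical
  set L := w.toWord with hL
  let B : Finset (FreeGroup α) := (L.tails.map FreeGroup.mk).toFinset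
  have hB : ∀ M, M <:+ L → FreeGroup.mk M ∈ B := by
    intro M hM
    simp only [B, List.mem_toFinset, List.mem_map, List.mem_tails]
    exact ⟨M, hM, rfl⟩
  have key : ∀ a : α, ∃ σ : Equiv.Perm B, ∀ x : B, FreeGroup.of a * (x : FreeGroup α) ∈ B →
      ((σ x : B) : FreeGroup α) = FreeGroup.of a * x := by
    intro a
    obtain ⟨g, hg⟩ := Set.MapsTo.exists_equiv_extend_of_card_eq (α := B) (t := B)
      (by simp) (s := {x : B | FreeGroup.of a * (x : FreeGroup α) ∈ B})
      (f := fun x => FreeGroup.of a * (x : FreeGroup α)) (fun x hx => hx)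
      (fun x _ y _ h => Subtype.ext (mul_left_cancel h))
    exact ⟨g, fun x hx => hg x hx⟩
  choose σ hσ using key
  refine ⟨Equiv.Perm B, inferInstance, inferInstance, FreeGroup.lift σ, ?_⟩
  have h1 : (1 : FreeGroup α) ∈ B := hB [] (List.nil_suffix)
  have main : ∀ M, M <:+ L →
      ((FreeGroup.lift σ (FreeGroup.mk M) ⟨1, h1⟩ : B) : FreeGroup α) = FreeGroup.mk M := by
    intro M
    induction M with
    | nil => intro _; simp [← FreeGroup.one_eq_mk]
    | cons c M ih =>
      intro hM
      have hM' : M <:+ L := (List.suffix_cons c M).trans hM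
      have ih := ih hM'
      obtain ⟨a, b⟩ := c
      have e : FreeGroup.mk ((a, b) :: M) = FreeGroup.mk [(a, b)] * FreeGroup.mk M := by
        simp [FreeGroup.mul_mk]
      have hin := hB _ hM
      have hinM := hB _ hM'
      have ih' : (FreeGroup.lift σ (FreeGroup.mk M) ⟨1, h1⟩ : B) = ⟨FreeGroup.mk M, hinM⟩ :=
        Subtype.ext ih
      rw [e] at hin ⊢
      rw [map_mul, Equiv.Perm.mul_apply, ih']
      cases b with
      | true =>
        have : FreeGroup.mk [(a, true)] = FreeGroup.of a := rfl
        rw [this] at hin ⊢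
        rw [FreeGroup.lift_apply_of]
        exact hσ a ⟨_, hinM⟩ hin
      | false =>
        have : FreeGroup.mk [(a, false)] = (FreeGroup.of a)⁻¹ := by
          simp [FreeGroup.of, FreeGroup.inv_mk, FreeGroup.invRev]
        rw [this] at hin ⊢
        rw [map_inv, FreeGroup.lift_apply_of]
        have h2 : σ a ⟨_, hin⟩ = ⟨FreeGroup.mk M, hinM⟩ := by
          apply Subtype.ext
          rw [hσ a ⟨_, hin⟩ (by simpa using hinM)]
          simp
        rw [← h2]; simp
  intro h
  have := main L (List.suffix_refl _)
  rw [hL, FreeGroup.mk_toWord, h] at this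
  exact hw this.symm

theorem fg_hopf (p : FreeGroup Bool →* FreeGroup Bool) (hp : Function.Surjective p) :
    Function.Injective p := by
  rw [injective_iff_map_eq_one]
  intro w hw
  by_contra hne
  obtain ⟨Q, _, _, ρ, hρ⟩ := fg_resfin w hne
  have : Finite (FreeGroup Bool →* Q) := Finite.of_equiv _ (FreeGroup.lift (α := Bool) (β := Q))
  have hi : Function.Injective (fun r : FreeGroup Bool →* Q => r.comp p) := by
    intro r s h
    exact (MonoidHom.cancel_right hp).1 h
  obtain ⟨r, hr⟩ := (Finite.injective_iff_surjective.1 hi) ρ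
  apply hρ
  rw [← hr]
  simp [hw]

theorem fg_comm_of_subsingleton {X : Type} [Subsingleton X] (x y : FreeGroup X) :
    Commute x y := by
  induction x using FreeGroup.induction_on with
  | C1 => exact Commute.one_left _
  | of a =>
    induction y using FreeGroup.induction_on with
    | C1 => exact Commute.one_right _
    | of b => rw [Subsingleton.elim a b]
    | inv_of b h => exact h.inv_right
    | mul u v hu hv => exact hu.mul_right hv
  | inv_of b h => exact h.inv_left
  | mul u v hu hv => exact hu.mul_left hv

theorem fg_comm {β : Type} (f : FreeGroup Bool →* FreeGroup β) (hf : ¬ Function.Injective f)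
    (x y : FreeGroup Bool) : f (x * y) = f (y * x) := by
  classical
  let X := IsFreeGroup.Generators f.range
  let e : f.range ≃* FreeGroup X := IsFreeGroup.toFreeGroup f.range
  let p : FreeGroup Bool →* FreeGroup X := e.toMonoidHom.comp f.rangeRestrict
  have hp : Function.Surjective p := e.surjective.comp f.rangeRestrict_surjective
  have hpf : ∀ u v, p u = p v ↔ f u = f v := by
    intro u v
    constructor
    · intro h
      exact congrArg Subtype.val (e.injective h)
    · intro h
      exact congrArg e (Subtype.ext h)
  let Z := Multiplicative (ZMod 2)
  have hZ : Nat.card Z = 2 := by simp [Z]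
  have : Finite Z := Nat.finite_of_card_ne_zero (by omega)
  let T : (X → Z) → (Bool → Z) := fun φ => FreeGroup.lift.symm ((FreeGroup.lift φ).comp p)
  have hT : Function.Injective T := by
    intro φ ψ h
    have := FreeGroup.lift.symm.injective h
    exact FreeGroup.lift.injective ((MonoidHom.cancel_right hp).1 this)
  have : Finite (X → Z) := Finite.of_injective T hT
  have : Nontrivial Z := Finite.one_lt_card_iff_nontrivial.1 (by omega)
  have hXf : Finite X := by
    obtain ⟨z, hz⟩ := exists_ne (1 : Z)
    refine Finite.of_injective (fun x : X => (Pi.mulSingle x z : X → Z)) ?_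
    intro x y h
    by_contra hne
    have := congrFun h x
    simp [Pi.mulSingle_eq_of_ne hne] at this
    exact hz this
  have hc := Nat.card_le_card_of_injective T hT
  rw [Nat.card_fun, Nat.card_fun, hZ] at hc
  have hc2 : Nat.card X ≤ 2 := by
    have := (Nat.pow_le_pow_iff_right (by norm_num : 1 < 2)).1 hc
    simpa using this
  rcases Nat.lt_or_ge (Nat.card X) 2 with h | h
  · have : Subsingleton X := Finite.card_le_one_iff_subsingleton.1 (by omega)
    rw [← hpf, map_mul, map_mul]
    exact fg_comm_of_subsingleton _ _
  · exfalso
    have h2 : Nat.card X = Nat.card Bool := by simp; omega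
    obtain ⟨ε⟩ := Finite.card_eq.1 h2 
    let q : FreeGroup Bool →* FreeGroup Bool := (FreeGroup.freeGroupCongr ε).toMonoidHom.comp p
    have hq := fg_hopf q ((FreeGroup.freeGroupCongr ε).surjective.comp hp)
    apply hf
    intro u v huv
    apply hq
    exact congrArg (FreeGroup.freeGroupCongr ε) ((hpf u v).2 huv)

theorem fg_exists_phi (E : Subgroup (FreeGroup Bool)) [hN : E.Normal]
    (hc : ∀ x y : FreeGroup Bool, (x * y)⁻¹ * (y * x) ∈ E) (x : FreeGroup Bool)
    (hx : ∀ k : ℕ, k ≠ 0 → x ^ k ∉ E) :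
    ∃ φ : FreeGroup Bool →* Multiplicative ℤ, (∀ e ∈ E, φ e = 1) ∧ φ ≠ 1 := by
  let _ : CommGroup (FreeGroup Bool ⧸ E) :=
    { QuotientGroup.Quotient.group E with
      mul_comm := by
        intro u v
        obtain ⟨u, rfl⟩ := QuotientGroup.mk_surjective u
        obtain ⟨v, rfl⟩ := QuotientGroup.mk_surjective v
        exact QuotientGroup.eq.2 (hc u v) }
  let π : FreeGroup Bool →* FreeGroup Bool ⧸ E := QuotientGroup.mk' E
  let M := Additive (FreeGroup Bool ⧸ E)
  have hfg : Group.FG (FreeGroup Bool ⧸ E) :=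
    Group.fg_of_surjective (f := π) (QuotientGroup.mk'_surjective E)
  have : AddGroup.FG M := AddGroup.fg_iff_mul_fg.2 hfg
  have : Module.Finite ℤ M := Module.Finite.iff_addGroup_fg.2 this
  let q := (Submodule.torsion ℤ M).mkQ
  let xm : M := Additive.ofMul (π x)
  have hq : q xm ≠ 0 := by
    intro h
    have h := (Submodule.Quotient.mk_eq_zero _).1 h
    rw [Submodule.mem_torsion_iff] at h
    obtain ⟨a, ha⟩ := h
    have ha0 : (a : ℤ) ≠ 0 := nonZeroDivisors.coe_ne_zero a
    have ha' : π x ^ (a : ℤ) = 1 := ha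
    have : π x ^ (a : ℤ).natAbs = 1 := by
      rwa [pow_natAbs_eq_one]
    rw [← map_pow] at this
    exact hx _ (Int.natAbs_ne_zero.2 ha0) ((QuotientGroup.eq_one_iff _).1 this)
  have := mt (Module.forall_dual_apply_eq_zero_iff ℤ (q xm)).1 hq
  push Not at this
  obtain ⟨f, hf⟩ := this
  let F : M →+ ℤ := (f.comp q).toAddMonoidHom
  refine ⟨(AddMonoidHom.toMultiplicativeRight F).comp π, ?_, ?_⟩
  · intro e he
    have : π e = 1 := (QuotientGroup.eq_one_iff _).2 he
    simp [this]
  · intro h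
    have := DFunLike.congr_fun h x
    exact hf this

theorem perm_apply_inv {α : Type} (f : Equiv.Perm α) (x : α) : f (f⁻¹ x) = x := by
  rw [← Equiv.Perm.mul_apply, mul_inv_cancel, Equiv.Perm.one_apply]

def affP (n : ℤ) (u : ℚ) : Equiv.Perm ℚ where
  toFun x := 2 ^ n * x + u
  invFun x := (2 ^ n)⁻¹ * (x - u)
  left_inv x := by
    have : (2 : ℚ) ^ n ≠ 0 := by positivity
    field_simp
    ring
  right_inv x := by
    have : (2 : ℚ) ^ n ≠ 0 := by positivity
    field_simp
    ring

theorem fg_not_fg (E : Subgroup (FreeGroup Bool)) [hN : E.Normal]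
    (hc : ∀ x y : FreeGroup Bool, (x * y)⁻¹ * (y * x) ∈ E)
    (φ : FreeGroup Bool →* Multiplicative ℤ) (hφE : ∀ e ∈ E, φ e = 1) (hφ : φ ≠ 1) :
    ¬ E.FG := by
  classical
  let d : FreeGroup Bool → ℤ := fun w => Multiplicative.toAdd (φ w)
  obtain ⟨c, hcn⟩ : ∃ c : Bool, d (FreeGroup.of c) ≠ 0 := by
    by_contra! h
    apply hφ
    ext c
    exact h c
  let ψ : FreeGroup Bool →* Equiv.Perm ℚ :=
    FreeGroup.lift fun s => affP (d (FreeGroup.of s)) (if s = c then 0 else 1)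
  have hd1 : d 1 = 0 := by simp [d]
  have hdm : ∀ u v, d (u * v) = d u + d v := by intro u v; simp [d]
  have hdi : ∀ u, d u⁻¹ = - d u := by intro u; simp [d]
  have aff : ∀ w x, ψ w x = 2 ^ (d w) * x + ψ w 0 := by
    intro w
    induction w using FreeGroup.induction_on with
    | C1 => intro x; simp [hd1]
    | of s => intro x; simp [ψ, affP]
    | inv_of s h =>
      intro x
      have h0 : (2 : ℚ) ^ d (FreeGroup.of s) ≠ 0 := by positivity
      have h1 := h (ψ (FreeGroup.of s)⁻¹ x)
      have h2 := h (ψ (FreeGroup.of s)⁻¹ 0)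
      rw [map_inv] at h1 h2 ⊢
      rw [perm_apply_inv] at h1 h2
      rw [hdi, zpow_neg]
      field_simp
      linarith
    | mul u v hu hv =>
      intro x
      rw [map_mul, Equiv.Perm.mul_apply, Equiv.Perm.mul_apply, hu, hv, hu (ψ v 0), hdm,
        zpow_add₀ (by norm_num)]
      ring
  have haE : ∀ e ∈ E, ∀ x, ψ e x = x + ψ e 0 := by
    intro e he x
    have : d e = 0 := by simp [d, hφE e he]
    rw [aff, this]; simp
  rintro ⟨T, hT⟩
  let N : ℕ := ∏ t ∈ T, (ψ t 0).den
  have hN0 : N ≠ 0 := Finset.prod_ne_zero_iff.2 fun t _ => (ψ t 0).den_nz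
  have hint : ∀ e ∈ E, ∃ z : ℤ, (N : ℚ) * ψ e 0 = z := by
    intro e he
    have he' := he
    rw [← hT] at he'
    induction he' using Subgroup.closure_induction with
    | mem t ht =>
      obtain ⟨k, hk⟩ : (ψ t 0).den ∣ N := Finset.dvd_prod_of_mem (fun t => (ψ t 0).den) ht
      refine ⟨k * (ψ t 0).num, ?_⟩
      rw [hk]
      push_cast
      have := Rat.den_mul_eq_num (ψ t 0)
      linear_combination (k : ℚ) * this
    | one => exact ⟨0, by simp⟩
    | mul u v hu hv hu' hv' =>
      rw [hT] at hu hv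
      obtain ⟨a, ha⟩ := hu' hu
      obtain ⟨b, hb⟩ := hv' hv
      refine ⟨a + b, ?_⟩
      rw [map_mul, Equiv.Perm.mul_apply, haE u hu]
      push_cast
      linear_combination ha + hb
    | inv u hu hu' =>
      rw [hT] at hu
      obtain ⟨a, ha⟩ := hu' hu
      refine ⟨-a, ?_⟩
      have := haE u hu (ψ u⁻¹ 0)
      rw [map_inv] at this ⊢
      rw [perm_apply_inv] at this
      push_cast
      linear_combination -ha - (N : ℚ) * this
  set n := d (FreeGroup.of c) with hn
  have hψc : ∀ x, ψ (FreeGroup.of c) x = 2 ^ n * x := by intro x; simp [ψ, affP, hn]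
  have hψcz : ψ (FreeGroup.of c) 0 = 0 := by rw [hψc]; simp
  let g : FreeGroup Bool := FreeGroup.of c
  let b : FreeGroup Bool := FreeGroup.of (!c)
  let e0 := (g * b)⁻¹ * (b * g)
  have he0 : e0 ∈ E := hc g b
  have hp : ψ e0 0 ≠ 0 := by
    intro h
    have h3 : ψ (b * g) 0 = ψ (g * b) 0 := by
      have : b * g = (g * b) * e0 := (mul_inv_cancel_left _ _).symm
      rw [this, map_mul, Equiv.Perm.mul_apply, h]
    rw [map_mul, map_mul, Equiv.Perm.mul_apply, Equiv.Perm.mul_apply, hψcz, hψc] at h3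
    have h4 : ψ b 0 = 1 := by
      simp [ψ, affP, b]
    rw [h4] at h3
    have h5 : (2 : ℚ) ^ n = 2 ^ (0 : ℤ) := by rw [zpow_zero]; linarith
    exact hcn (zpow_right_injective₀ (by norm_num) (by norm_num) h5)
  have hg0 : ∀ k : ℤ, ψ (g ^ k) 0 = 0 := by
    intro k
    rw [map_zpow]
    exact Function.IsFixedPt.perm_zpow hψcz k
  have hdz : ∀ k : ℤ, d (g ^ k) = k * n := by intro k; simp [d, hn, g]
  have hval : ∀ k : ℤ, ψ (g ^ k * e0 * (g ^ k)⁻¹) 0 = 2 ^ (k * n) * ψ e0 0 := by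
    intro k
    have : ψ (g ^ k)⁻¹ 0 = 0 := by rw [← zpow_neg]; exact hg0 _
    rw [map_mul, map_mul, Equiv.Perm.mul_apply, Equiv.Perm.mul_apply, this, aff (g ^ k), hg0, hdz]
    simp
  obtain ⟨j, hj⟩ := pow_unbounded_of_one_lt |(N : ℚ) * ψ e0 0| (by norm_num : (1 : ℚ) < 2)
  obtain ⟨z, hz⟩ := hint _ (hN.conj_mem e0 he0 (g ^ (-(n * j))))
  rw [hval] at hz
  have hz0 : z ≠ 0 := by
    rintro rfl
    have : (2 : ℚ) ^ (-(n * j) * n) ≠ 0 := by positivity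
    have hN0' : (N : ℚ) ≠ 0 := by exact_mod_cast hN0
    rw [Int.cast_zero] at hz
    exact mul_ne_zero hN0' (mul_ne_zero this hp) hz
  have h1 : (1 : ℚ) ≤ |(z : ℚ)| := by exact_mod_cast Int.one_le_abs hz0
  have h2 : (z : ℚ) * 2 ^ (n * n * j) = N * ψ e0 0 := by
    rw [← hz, show -(n * (j : ℤ)) * n = -(n * n * j) by ring, zpow_neg]
    have : (2 : ℚ) ^ (n * n * j) ≠ 0 := by positivity
    field_simp
  have h3 : (2 : ℚ) ^ j ≤ 2 ^ (n * n * (j : ℤ)) := by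
    rw [← zpow_natCast]
    apply zpow_le_zpow_right₀ (by norm_num)
    have : 1 ≤ n * n := by have := mul_self_pos.2 hcn; omega
    nlinarith [Int.natCast_nonneg j]
  rw [← h2, abs_mul, abs_of_pos (by positivity : (0 : ℚ) < 2 ^ (n * n * (j : ℤ)))] at hj
  have : (0 : ℚ) < 2 ^ (n * n * (j : ℤ)) := by positivity
  nlinarith


/-- if `S` is a set of at least two homomorphisms `F(a,b) → F(Δ)`, none of
which is injective, then `Eq(S)` is a nontrivial normal subgroup of infinite index in
`F(a,b)`, and hence not finitely generated. (`F(a,b)` is modelled as `FreeGroup Bool`;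
infinite index is `Subgroup.index = 0`.) -/
theorem stmt_11 {β : Type} (S : Set (FreeGroup Bool →* FreeGroup β))
    (hcard : S.Nontrivial) (hnoninj : ∀ g ∈ S, ¬ Function.Injective g)
    (E : Subgroup (FreeGroup Bool))
    (hE : E = ⨅ g ∈ S, ⨅ h ∈ S, MonoidHom.eqLocus g h) :
    E ≠ ⊥ ∧ E.Normal ∧ E.index = 0 ∧ ¬ E.FG := by
  have hmem : ∀ x, x ∈ E ↔ ∀ g ∈ S, ∀ h ∈ S, g x = h x := by
    intro x
    rw [hE]
    simp only [Subgroup.mem_iInf]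
    rfl
  have hc : ∀ x y : FreeGroup Bool, (x * y)⁻¹ * (y * x) ∈ E := by
    intro x y
    rw [hmem]
    have : ∀ g ∈ S, g ((x * y)⁻¹ * (y * x)) = 1 := by
      intro g hg
      rw [map_mul, map_inv, fg_comm g (hnoninj g hg) x y, inv_mul_cancel]
    intro g hg h hh
    rw [this g hg, this h hh]
  have hN : E.Normal := by
    constructor
    intro e he g
    have h1 := hc (g⁻¹) (g * e)
    have : g * e * g⁻¹ = e * ((g⁻¹ * (g * e))⁻¹ * (g * e * g⁻¹)) := by group
    rw [this]
    exact E.mul_mem he h1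
  obtain ⟨g, hg, h, hh, hne⟩ := hcard
  obtain ⟨x, hx⟩ : ∃ x, g x ≠ h x := by
    by_contra! H
    exact hne (MonoidHom.ext H)
  have hxk : ∀ k : ℕ, k ≠ 0 → x ^ k ∉ E := by
    intro k hk hmm
    have := (hmem _).1 hmm g hg h hh
    rw [map_pow, map_pow] at this
    exact hx (pow_left_injective hk this)
  refine ⟨?_, hN, ?_, ?_⟩
  · rintro rfl
    have := Subgroup.mem_bot.1 (hc (FreeGroup.of true) (FreeGroup.of false))
    revert this
    decide
  · by_contra hi
    exact hxk _ hi (Subgroup.pow_index_mem E x)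
  · obtain ⟨φ, h1, h2⟩ := fg_exists_phi E hc x hxk
    exact fg_not_fg E hc φ h1 h2
end

section
/- Let g, h : F(Σ) → F(Δ) be injective homomorphisms of free groups with |Σ| finite, such that both im(g) and im(h) are retracts of ⟨im(g) ∪ im(h)⟩ and im(g) ≠ im(h). Then every subgroup H_i (i ≥ 1) in the defining chain of SD(g,h), and SD(g,h) itself, is a proper retract of F(Σ). -/
def IsRetract {G : Type*} [Group G] (H : Subgroup G) : Prop :=
  ∃ ρ : G →* G, (∀ x, ρ x ∈ H) ∧ ∀ x ∈ H, ρ x = x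

/-- `A` is a retract of the subgroup `B` (for `A ≤ B`). -/
def IsRetractIn {G : Type*} [Group G] (A B : Subgroup G) : Prop :=
  ∃ ρ : ↥B →* G, (∀ x, ρ x ∈ A) ∧ ∀ x : ↥B, (x : G) ∈ A → ρ x = x

/-- The descending chain in the definition of the stable domain. -/
def SDChain {α β : Type} (g h : FreeGroup α →* FreeGroup β) : ℕ → Subgroup (FreeGroup α)
  | 0 => ⊤
  | i + 1 =>
      Subgroup.comap g (Subgroup.map g (SDChain g h i) ⊓ Subgroup.map h (SDChain g h i))

/-- The stable domain `SD(g,h)`. -/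
def SD {α β : Type} (g h : FreeGroup α →* FreeGroup β) : Subgroup (FreeGroup α) :=
  ⨅ i, SDChain g h i



section Part1

/-- A numerical rank substitute: the number of homomorphisms to `ℤ/2`. -/
noncomputable def nuRank (G : Type) [Group G] : ℕ := Nat.card (G →* Multiplicative (ZMod 2))

lemma ball_finite {α : Type} [Finite α] [DecidableEq α] (k : ℕ) :
    Finite {v : FreeGroup α // v.norm ≤ k} := by
  have h : Finite {l : List (α × Bool) // l.length ≤ k} := (List.finite_length_le (α × Bool) k)
  exact Finite.of_injective
    (fun v : {v : FreeGroup α // v.norm ≤ k} =>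
      (⟨v.1.toWord, v.2⟩ : {l : List (α × Bool) // l.length ≤ k}))
    (fun a b hab => Subtype.ext (FreeGroup.toWord_injective (congrArg Subtype.val hab)))

lemma freeGroup_resFin {α : Type} [Finite α] (w : FreeGroup α) (hw : w ≠ 1) :
    ∃ (V : Type) (_ : Finite V) (π : FreeGroup α →* Equiv.Perm V), π w ≠ 1 := by
  classical
  obtain ⟨k, hk⟩ : ∃ k, k = w.norm := ⟨_, rfl⟩
  let V := {v : FreeGroup α // v.norm ≤ k}
  have hV : Finite V := ball_finite k
  have : Fintype V := Fintype.ofFinite V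
  let e : ∀ x : α, {v : V // (FreeGroup.of x * v.1).norm ≤ k} ≃
      {v : V // ((FreeGroup.of x)⁻¹ * v.1).norm ≤ k} := fun x =>
    { toFun := fun v => ⟨⟨FreeGroup.of x * v.1.1, v.2⟩, by simpa using v.1.2⟩
      invFun := fun v => ⟨⟨(FreeGroup.of x)⁻¹ * v.1.1, v.2⟩, by simpa using v.1.2⟩
      left_inv := fun v => by ext; simp
      right_inv := fun v => by ext; simp }
  let π : FreeGroup α →* Equiv.Perm V := FreeGroup.lift (fun x => (e x).extendSubtype)
  have hx : ∀ (x : α) (v : V) (h : (FreeGroup.of x * v.1).norm ≤ k),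
      π (FreeGroup.of x) v = ⟨FreeGroup.of x * v.1, h⟩ := by
    intro x v h
    simp only [π, FreeGroup.lift_apply_of]
    rw [Equiv.extendSubtype_apply_of_mem (e x) v h]
    rfl
  have key : ∀ (L : List (α × Bool)) (hL : L.length ≤ k),
      π (FreeGroup.mk L) ⟨1, by simp⟩ = ⟨FreeGroup.mk L, FreeGroup.norm_mk_le.trans hL⟩ := by
    intro L
    induction L with
    | nil => intro hL; simp [← FreeGroup.one_eq_mk]
    | cons a L ih =>
      intro hL
      have hL' : L.length ≤ k := by simp at hL; omega
      have e1 : FreeGroup.mk (a :: L) = FreeGroup.mk [a] * FreeGroup.mk L := by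
        simp [FreeGroup.mul_mk]
      have hn : (FreeGroup.mk (a :: L)).norm ≤ k := FreeGroup.norm_mk_le.trans hL
      have hn' : (FreeGroup.mk L).norm ≤ k := FreeGroup.norm_mk_le.trans hL'
      have h2 : π (FreeGroup.mk (a :: L)) ⟨1, by simp⟩ =
          π (FreeGroup.mk [a]) ⟨FreeGroup.mk L, hn'⟩ := by
        rw [e1, map_mul, Equiv.Perm.mul_apply, ih hL']
      rw [h2]
      obtain ⟨x, b⟩ := a
      cases b with
      | true =>
        have := hx x ⟨FreeGroup.mk L, hn'⟩ (by rw [e1] at hn; exact hn)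
        simp only [FreeGroup.of] at this
        rw [this]
        exact Subtype.ext e1.symm
      | false =>
        have e3 : FreeGroup.mk [(x, false)] = (FreeGroup.of x)⁻¹ := by
          simp [FreeGroup.of, FreeGroup.invRev]
        rw [e3, map_inv, Equiv.Perm.inv_eq_iff_eq]
        have e4 : FreeGroup.of x * FreeGroup.mk ((x, false) :: L) = FreeGroup.mk L := by
          rw [e1, e3]; simp
        rw [hx x ⟨_, hn⟩ (by simpa [e4] using hn')]
        exact Subtype.ext e4.symm
  refine ⟨V, hV, π, fun h => hw ?_⟩
  have := key w.toWord (by rw [hk]; exact le_rfl)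
  have := congrArg Subtype.val this
  simp only [FreeGroup.mk_toWord, h] at this
  simpa using this.symm

lemma freeGroup_hom_finite {α Q : Type} [Finite α] [Group Q] [Finite Q] :
    Finite (FreeGroup α →* Q) :=
  Finite.of_equiv (α → Q) FreeGroup.lift

lemma freeGroup_hopf {α : Type} [Finite α] (φ : FreeGroup α →* FreeGroup α)
    (h : Function.Surjective φ) : Function.Injective φ := by
  rw [injective_iff_map_eq_one]
  intro w hw
  by_contra hne
  obtain ⟨V, hV, π, hπ⟩ := freeGroup_resFin w hne
  have : Finite (FreeGroup α →* Equiv.Perm V) := freeGroup_hom_finite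
  have hinj : Function.Injective (fun p : FreeGroup α →* Equiv.Perm V => p.comp φ) := by
    intro p q hpq
    exact (MonoidHom.cancel_right h).1 hpq
  obtain ⟨p, hp⟩ := (Finite.injective_iff_surjective.1 hinj) π
  apply hπ
  rw [← hp]
  simp [hw]

lemma hom_finite_of_fg {G : Type} [Group G] (hG : Group.FG G) :
    Finite (G →* Multiplicative (ZMod 2)) := by
  obtain ⟨α, hα, φ, hφ⟩ := (Group.fg_iff_exists_freeGroup_hom_surjective_finite).1 hG
  have : Finite (Multiplicative (ZMod 2)) := inferInstanceAs (Finite (ZMod 2))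
  have : Finite (FreeGroup α →* Multiplicative (ZMod 2)) := freeGroup_hom_finite
  exact Finite.of_injective (fun p : G →* Multiplicative (ZMod 2) => p.comp φ)
    (fun p q hpq => (MonoidHom.cancel_right hφ).1 hpq)

lemma nuRank_le_of_surjective {G G' : Type} [Group G] [Group G'] (hG : Group.FG G) (f : G →* G')
    (hf : Function.Surjective f) : nuRank G' ≤ nuRank G := by
  have := hom_finite_of_fg hG
  exact Nat.card_le_card_of_injective
    (fun p : G' →* Multiplicative (ZMod 2) => p.comp f)
    (fun p q hpq => (MonoidHom.cancel_right hf).1 hpq)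

lemma exists_equiv_freeGroup {G : Type} [Group G] [IsFreeGroup G] (hG : Group.FG G) :
    ∃ A : Type, ∃ _ : Finite A, Nonempty (G ≃* FreeGroup A) ∧ nuRank G = 2 ^ Nat.card A := by
  let A := IsFreeGroup.Generators G
  have e : G ≃* FreeGroup A := IsFreeGroup.toFreeGroup G
  have h1 : (A → Multiplicative (ZMod 2)) ≃ (G →* Multiplicative (ZMod 2)) :=
    IsFreeGroup.lift
  have := hom_finite_of_fg hG
  have : Finite (A → Multiplicative (ZMod 2)) := Finite.of_equiv _ h1.symm
  have : Nontrivial (Multiplicative (ZMod 2)) := inferInstanceAs (Nontrivial (ZMod 2))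
  have hA : Finite A := by
    by_contra hinf
    rw [not_finite_iff_infinite] at hinf
    have : Infinite (A → Multiplicative (ZMod 2)) := inferInstance
    exact not_finite (A → Multiplicative (ZMod 2))
  refine ⟨A, hA, ⟨e⟩, ?_⟩
  unfold nuRank
  rw [← Nat.card_congr h1, Nat.card_fun]
  congr 1
  exact Nat.card_zmod 2

lemma hopf_of_nuRank {G G' : Type} [Group G] [Group G'] [IsFreeGroup G] [IsFreeGroup G']
    (hG : Group.FG G) (f : G →* G') (hf : Function.Surjective f) (h : nuRank G ≤ nuRank G') :
    Function.Injective f := by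
  have := hG
  have hG' : Group.FG G' := Group.fg_of_surjective hf
  have heq : nuRank G = nuRank G' := le_antisymm h (nuRank_le_of_surjective hG f hf)
  obtain ⟨A, hA, ⟨e⟩, h1⟩ := exists_equiv_freeGroup hG
  obtain ⟨B, hB, ⟨e'⟩, h2⟩ := exists_equiv_freeGroup hG'
  rw [h1, h2] at heq
  have hc : Nat.card A = Nat.card B := Nat.pow_right_injective (le_refl 2) heq
  let c : A ≃ B := (Finite.card_eq.1 hc).some
  let c' : FreeGroup B ≃* FreeGroup A := (FreeGroup.freeGroupCongr c).symm
  let φ : FreeGroup A →* FreeGroup A :=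
    ((c'.toMonoidHom.comp e'.toMonoidHom).comp f).comp e.symm.toMonoidHom
  have hφ : Function.Surjective φ :=
    ((c'.surjective.comp e'.surjective).comp hf).comp e.symm.surjective
  have hi := freeGroup_hopf φ hφ
  intro x y hxy
  have : φ (e x) = φ (e y) := by simp [φ, hxy]
  exact e.injective (hi this)

end Part1


section Part2

lemma exists_cocycle {X Ω M : Type} [Group M] (τ : FreeGroup X →* Equiv.Perm Ω) (a : X → Ω → M) :
    ∃ c : FreeGroup X → Ω → M,
      (∀ g g' ω, c (g * g') ω = c g ω * c g' ((τ g)⁻¹ ω)) ∧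
      (∀ x ω, c (FreeGroup.of x) ω = a x ω) := by
  let act : FreeGroup X →* MulAut (Ω → M) := (mulAutArrow (G := Equiv.Perm Ω)).comp τ
  let Φ : FreeGroup X →* (Ω → M) ⋊[act] FreeGroup X :=
    FreeGroup.lift (fun x => ⟨a x, FreeGroup.of x⟩)
  have hr : ∀ g, (Φ g).right = g := by
    have : (SemidirectProduct.rightHom.comp Φ) = MonoidHom.id _ := by
      ext x
      simp [Φ]
    intro g
    exact DFunLike.congr_fun this g
  refine ⟨fun g => (Φ g).left, ?_, ?_⟩
  · intro g g' ω
    change (Φ (g*g')).left ω = (Φ g).left ω * (Φ g').left ((τ g)⁻¹ ω)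
    rw [map_mul, SemidirectProduct.mul_left, hr]
    rfl
  · intro x ω
    simp [Φ]

lemma mk_cons_eq {X : Type} (a : X × Bool) (L : List (X × Bool)) :
    FreeGroup.mk (a :: L) = FreeGroup.mk [a] * FreeGroup.mk L := by
  simp [FreeGroup.mul_mk]

lemma mk_false_eq {X : Type} (x : X) :
    FreeGroup.mk [(x, false)] = (FreeGroup.of x)⁻¹ := by
  simp [FreeGroup.of, FreeGroup.invRev]

lemma cocycle_one {X Ω M : Type} [Group M] (τ : FreeGroup X →* Equiv.Perm Ω)
    (c : FreeGroup X → Ω → M)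
    (hc : ∀ g g' ω, c (g * g') ω = c g ω * c g' ((τ g)⁻¹ ω)) (ω : Ω) : c 1 ω = 1 := by
  have := hc 1 1 ω
  simpa using this

lemma cocycle_inv {X Ω M : Type} [Group M] (τ : FreeGroup X →* Equiv.Perm Ω)
    (c : FreeGroup X → Ω → M)
    (hc : ∀ g g' ω, c (g * g') ω = c g ω * c g' ((τ g)⁻¹ ω)) (g : FreeGroup X) (ω : Ω) :
    c g⁻¹ ω = (c g (τ g ω))⁻¹ := by
  have := hc g⁻¹ g ω
  rw [inv_mul_cancel, cocycle_one τ c hc] at this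
  simp only [map_inv, inv_inv] at this
  exact eq_inv_of_mul_eq_one_left this.symm

lemma cocycle_mem {X Ω M : Type} [Group M] (τ : FreeGroup X →* Equiv.Perm Ω)
    (c : FreeGroup X → Ω → M)
    (hc : ∀ g g' ω, c (g * g') ω = c g ω * c g' ((τ g)⁻¹ ω)) (K : Subgroup M)
    (hK : ∀ x ω, c (FreeGroup.of x) ω ∈ K) (g : FreeGroup X) : ∀ ω, c g ω ∈ K := by
  induction g using FreeGroup.induction_on with
  | C1 => intro ω; rw [cocycle_one τ c hc]; exact K.one_mem
  | of x => exact hK x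
  | inv_of x _ => intro ω; rw [cocycle_inv τ c hc]; exact K.inv_mem (hK _ _)
  | mul x y hx hy => intro ω; rw [hc]; exact K.mul_mem (hx _) (hy _)

open Classical in
lemma takahasi {α : Type} [Finite α] (E0 : Set (FreeGroup α)) (hE : E0.Finite) :
    ∃ F : Set (Subgroup (FreeGroup α)), F.Finite ∧ ∀ H : Subgroup (FreeGroup α),
      E0 ⊆ H → ∃ H' ∈ F, E0 ⊆ H' ∧ H' ≤ H ∧ IsRetractIn H' H := by
  let Ls : Set (List (α × Bool)) := {L | L = [] ∨ ∃ e ∈ E0, L <:+ e.toWord}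
  have hLs : Ls.Finite := by
    have : Ls ⊆ {[]} ∪ ⋃ e ∈ E0, {L | L ∈ e.toWord.tails} := by
      rintro L (rfl | ⟨e, he, hL⟩)
      · left; rfl
      · right
        simp only [Set.mem_iUnion]
        exact ⟨e, he, by simpa using hL⟩
    refine Set.Finite.subset ((Set.finite_singleton _).union (hE.biUnion ?_)) this
    intro e _
    exact List.finite_toSet _
  have hLs_cons : ∀ a L, (a :: L) ∈ Ls → L ∈ Ls := by
    rintro a L (h | ⟨e, he, hL⟩)
    · cases h
    · exact Or.inr ⟨e, he, (List.suffix_cons a L).trans hL⟩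
  let P : Set (FreeGroup α) := FreeGroup.mk '' Ls
  have hP : P.Finite := hLs.image _
  let Q : Set (FreeGroup α) :=
    (fun z : FreeGroup α × FreeGroup α × α => z.1⁻¹ * FreeGroup.of z.2.2 * z.2.1) ''
      (P ×ˢ (P ×ˢ Set.univ))
  have hQ : Q.Finite := ((hP.prod (hP.prod Set.finite_univ))).image _
  refine ⟨Subgroup.closure '' (𝒫 Q), (hQ.powerset).image _, ?_⟩
  intro H hEH
  let Ω := FreeGroup α ⧸ H
  let ω₀ : Ω := ((1 : FreeGroup α) : FreeGroup α ⧸ H)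
  let τ : FreeGroup α →* Equiv.Perm Ω := MulAction.toPermHom (FreeGroup α) Ω
  have hτ : ∀ g ω, τ g ω = g • ω := fun g ω => rfl
  have hτ' : ∀ g ω, (τ g)⁻¹ ω = g⁻¹ • ω := fun g ω => rfl
  let Ω₀ : Set Ω := (fun p : FreeGroup α => p • ω₀) '' P
  have hstab : ∀ g : FreeGroup α, g • ω₀ = ω₀ ↔ g ∈ H := by
    intro g
    change ((g * 1 : FreeGroup α) : FreeGroup α ⧸ H) = ((1 : FreeGroup α) : FreeGroup α ⧸ H) ↔ _
    rw [mul_one, eq_comm, QuotientGroup.eq]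
    simp
  have h1P : (1 : FreeGroup α) ∈ P := ⟨[], Or.inl rfl, rfl⟩
  have hω₀ : ω₀ ∈ Ω₀ := ⟨1, h1P, one_smul _ _⟩
  obtain ⟨t, ht0, htP, ht⟩ : ∃ t : Ω → FreeGroup α, t ω₀ = 1 ∧ (∀ ω ∈ Ω₀, t ω ∈ P) ∧
      ∀ ω ∈ Ω₀, t ω • ω₀ = ω := by
    refine ⟨fun ω => if ω = ω₀ then 1 else if h : ω ∈ Ω₀ then h.choose else 1, by simp, ?_, ?_⟩
    · intro ω h
      by_cases h0 : ω = ω₀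
      · simpa [h0] using h1P
      · simpa [h0, h] using h.choose_spec.1
    · intro ω h
      by_cases h0 : ω = ω₀
      · simp [h0]
      · simpa [h0, h] using h.choose_spec.2
  obtain ⟨c, hc, hca⟩ := exists_cocycle τ
    (fun x ω => if ω ∈ Ω₀ ∧ (FreeGroup.of x)⁻¹ • ω ∈ Ω₀ then
      (t ω)⁻¹ * FreeGroup.of x * t ((FreeGroup.of x)⁻¹ • ω) else 1)
  let Q' : Set (FreeGroup α) := {q | ∃ x ω, ω ∈ Ω₀ ∧ (FreeGroup.of x)⁻¹ • ω ∈ Ω₀ ∧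
    q = (t ω)⁻¹ * FreeGroup.of x * t ((FreeGroup.of x)⁻¹ • ω)}
  have hQ' : Q' ⊆ Q := by
    rintro q ⟨x, ω, h1, h2, rfl⟩
    exact ⟨(_, _, x), ⟨htP _ h1, htP _ h2, trivial⟩, rfl⟩
  have hQH : Subgroup.closure Q' ≤ H := by
    rw [Subgroup.closure_le]
    rintro q ⟨x, ω, h1, h2, rfl⟩
    rw [SetLike.mem_coe, ← hstab, mul_smul, mul_smul, ht _ h2, smul_inv_smul, inv_smul_eq_iff,
      ht _ h1]
  have hcK : ∀ g ω, c g ω ∈ Subgroup.closure Q' := by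
    apply cocycle_mem τ c hc
    intro x ω
    rw [hca]
    split_ifs with h
    · exact Subgroup.subset_closure ⟨x, ω, h.1, h.2, rfl⟩
    · exact Subgroup.one_mem _
  -- telescoping
  have hstep : ∀ (a : α × Bool) (ω : Ω), ω ∈ Ω₀ → FreeGroup.mk [a] • ω ∈ Ω₀ →
      c (FreeGroup.mk [a]) (FreeGroup.mk [a] • ω) =
        (t (FreeGroup.mk [a] • ω))⁻¹ * FreeGroup.mk [a] * t ω := by
    rintro ⟨x, b⟩ ω h1 h2
    cases b with
    | true =>
      change c (FreeGroup.of x) (FreeGroup.of x • ω) = _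
      rw [hca, if_pos ⟨h2, by rwa [inv_smul_smul]⟩, inv_smul_smul]
      rfl
    | false =>
      rw [mk_false_eq] at h2 ⊢
      rw [cocycle_inv τ c hc, hτ, smul_inv_smul, hca, if_pos ⟨h1, h2⟩]
      group
  have htel : ∀ L ∈ Ls, c (FreeGroup.mk L) (FreeGroup.mk L • ω₀) =
      (t (FreeGroup.mk L • ω₀))⁻¹ * FreeGroup.mk L := by
    intro L
    induction L with
    | nil =>
      intro _
      rw [← FreeGroup.one_eq_mk, cocycle_one τ c hc, one_smul, ht0]
      simp
    | cons a L ih =>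
      intro hL
      have hL' := hLs_cons a L hL
      have m1 : FreeGroup.mk L • ω₀ ∈ Ω₀ := ⟨_, ⟨L, hL', rfl⟩, rfl⟩
      have m2 : FreeGroup.mk [a] • FreeGroup.mk L • ω₀ ∈ Ω₀ :=
        ⟨_, ⟨a :: L, hL, rfl⟩, by simp only [mk_cons_eq a L, mul_smul]⟩
      rw [mk_cons_eq a L, mul_smul, hc, hτ', inv_smul_smul, ih hL', hstep a _ m1 m2]
      group
  have htelP : ∀ p ∈ P, c p (p • ω₀) = (t (p • ω₀))⁻¹ * p := by
    rintro p ⟨L, hL, rfl⟩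
    exact htel L hL
  refine ⟨Subgroup.closure Q', ⟨Q', hQ', rfl⟩, ?_, hQH, ?_⟩
  · intro e he
    have heP : e ∈ P := ⟨e.toWord, Or.inr ⟨e, he, List.suffix_rfl⟩, FreeGroup.mk_toWord⟩
    have := htelP e heP
    rw [(hstab e).2 (hEH he), ht0, inv_one, one_mul] at this
    rw [SetLike.mem_coe, ← this]
    exact hcK _ _
  · let ρ : ↥H →* FreeGroup α :=
      { toFun := fun h => c h ω₀
        map_one' := cocycle_one τ c hc _
        map_mul' := fun h h' => by
          rw [Subgroup.coe_mul, hc, hτ', (hstab _).2 (H.inv_mem h.2)] }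
    refine ⟨ρ, fun h => hcK _ _, ?_⟩
    have hle : Subgroup.closure Q' ≤ (ρ.eqLocus H.subtype).map H.subtype := by
      rw [Subgroup.closure_le]
      rintro q hq
      have hqH : q ∈ H := hQH (Subgroup.subset_closure hq)
      refine ⟨⟨q, hqH⟩, ?_, rfl⟩
      obtain ⟨x, ω, h1, h2, rfl⟩ := hq
      change c _ ω₀ = _
      have z1 : c (t ω)⁻¹ ω₀ = 1 := by
        rw [cocycle_inv τ c hc, hτ, htelP _ (htP _ h1), ht _ h1]
        simp
      have z2 : c (t ((FreeGroup.of x)⁻¹ • ω)) ((FreeGroup.of x)⁻¹ • ω) = 1 := by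
        have := htelP _ (htP _ h2)
        rw [ht _ h2] at this
        rw [this]; simp
      rw [hc, hc, z1, one_mul, hτ', hτ']
      rw [mul_inv_rev, inv_inv, mul_smul, ht _ h1, z2, mul_one, hca, if_pos ⟨h1, h2⟩]
      rfl
    intro h hh
    obtain ⟨h', hh', e⟩ := hle hh
    have : h' = h := Subtype.ext e
    subst this
    exact hh'

end Part2


section Part3

def Rigid {S : Type} [Group S] (E0 : Set S) : Prop :=
  ∀ ρ : S →* S, (∀ x, ρ (ρ x) = ρ x) → (∀ e ∈ E0, ρ e = e) → ∀ x, ρ x = x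

lemma fg_freeGroup {α : Type} [Finite α] : Group.FG (FreeGroup α) := inferInstance

lemma fg_range' {G H : Type} [Group G] [Group H] (hG : Group.FG G) (f : G →* H) :
    Group.FG f.range := by
  haveI := hG
  exact Group.fg_of_surjective f.rangeRestrict_surjective

lemma turner_T1 {α : Type} [Finite α] (E0 : Set (FreeGroup α)) (hE : E0.Finite) (hR : Rigid E0)
    (θ : FreeGroup α →* FreeGroup α) (hθ : ∀ e ∈ E0, θ e = e)
    (hmin : ∀ θ' : FreeGroup α →* FreeGroup α, (∀ e ∈ E0, θ' e = e) →
      nuRank θ.range ≤ nuRank θ'.range) : Function.Surjective θ := by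
  obtain ⟨F, hF, hFt⟩ := takahasi E0 hE
  obtain ⟨it, hit⟩ : ∃ it : ℕ → (FreeGroup α →* FreeGroup α), ∀ k x, it k x = θ^[k] x := by
    refine ⟨fun k => Nat.rec (MonoidHom.id _) (fun _ f => θ.comp f) k, ?_⟩
    intro k x
    induction k with
    | zero => rfl
    | succ k ih =>
      rw [Function.iterate_succ_apply', ← ih]
      rfl
  have hadd : ∀ m n x, it (m + n) x = it m (it n x) := by
    intro m n x
    simp only [hit, Function.iterate_add_apply]
  have hfix : ∀ k, ∀ e ∈ E0, it k e = e := by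
    intro k e he
    rw [hit]
    exact Function.iterate_fixed (hθ e he) k
  have hanti : ∀ m n, (it (m + n)).range ≤ (it m).range := by
    rintro m n _ ⟨x, rfl⟩
    exact ⟨it n x, (hadd m n x).symm⟩
  have hone : ∀ x, it 1 x = θ x := fun x => by rw [hit]; rfl
  have hnu : ∀ k, nuRank (it (k + 1)).range ≤ nuRank θ.range := by
    intro k
    let f : θ.range →* (it (k + 1)).range :=
      ((it k).comp θ.range.subtype).codRestrict _ (by
        rintro ⟨_, x, rfl⟩
        refine ⟨x, ?_⟩
        rw [hadd, hone]; rfl)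
    refine nuRank_le_of_surjective (fg_range' fg_freeGroup θ) f ?_
    rintro ⟨_, x, rfl⟩
    refine ⟨⟨θ x, x, rfl⟩, Subtype.ext ?_⟩
    change it k (θ x) = it (k + 1) x
    rw [hadd, hone]
  have hmem : ∀ k, (it (k + 1)).range ∈ F := by
    intro k
    obtain ⟨H', hH'F, hE', hle, r, hr1, hr2⟩ := hFt (it (k + 1)).range
      (fun e he => ⟨e, hfix _ e he⟩)
    let r' : (it (k + 1)).range →* H' := r.codRestrict _ hr1
    have hr's : Function.Surjective r' := by
      rintro ⟨y, hy⟩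
      exact ⟨⟨y, hle hy⟩, Subtype.ext (hr2 ⟨y, hle hy⟩ hy)⟩
    have h1 := hmin (r.comp (it (k + 1)).rangeRestrict) (by
      intro e he
      have : (it (k + 1)).rangeRestrict e = ⟨e, e, hfix _ e he⟩ := Subtype.ext (hfix _ e he)
      rw [MonoidHom.comp_apply, this]
      exact hr2 _ (hE' he))
    have h2 : (r.comp (it (k + 1)).rangeRestrict).range = H' := by
      apply le_antisymm
      · rintro _ ⟨x, rfl⟩
        exact hr1 _
      · intro y hy
        obtain ⟨x, hx⟩ := hle hy
        refine ⟨x, ?_⟩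
        have : (it (k + 1)).rangeRestrict x = ⟨y, hle hy⟩ := Subtype.ext hx
        rw [MonoidHom.comp_apply, this]
        exact hr2 _ hy
    rw [h2] at h1
    have hinj := hopf_of_nuRank (fg_range' fg_freeGroup _) r' hr's ((hnu k).trans h1)
    have : (it (k + 1)).range = H' := by
      apply le_antisymm _ hle
      intro x hx
      have e1 : r' ⟨r ⟨x, hx⟩, hle (hr1 _)⟩ = r' ⟨x, hx⟩ := Subtype.ext (hr2 _ (hr1 _))
      have e2 := congrArg Subtype.val (hinj e1)
      change r ⟨x, hx⟩ = x at e2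
      rw [← e2]; exact hr1 _
    rw [this]; exact hH'F
  obtain ⟨N, hN, hNN⟩ : ∃ N, 1 ≤ N ∧ (it N).range = (it (N + N)).range := by
    have hmem' : ∀ k : ℕ, (it (2 ^ k)).range ∈ F := by
      intro k
      have : 1 ≤ 2 ^ k := Nat.one_le_two_pow
      have := hmem (2 ^ k - 1)
      rwa [Nat.sub_add_cancel (by omega)] at this
    have hni : ¬ Function.Injective (fun k : ℕ => (it (2 ^ k)).range) := by
      intro hi
      exact Set.infinite_range_of_injective hi
        (hF.subset (by rintro _ ⟨k, rfl⟩; exact hmem' k))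
    have hab : ∃ i j : ℕ, i < j ∧ (it (2 ^ i)).range = (it (2 ^ j)).range := by
      simp only [Function.Injective, not_forall] at hni
      obtain ⟨i, j, h, hne⟩ := hni
      rcases lt_or_gt_of_ne hne with h' | h'
      · exact ⟨i, j, h', h⟩
      · exact ⟨j, i, h', h.symm⟩
    obtain ⟨i, j, hij, h⟩ := hab
    refine ⟨2 ^ i, Nat.one_le_two_pow, le_antisymm ?_ (hanti _ _)⟩
    rw [h]
    have : 2 ^ (i + 1) ≤ 2 ^ j := Nat.pow_le_pow_right (by norm_num) hij
    rw [pow_succ, mul_two] at this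
    obtain ⟨d, hd⟩ := Nat.exists_eq_add_of_le this
    rw [hd]
    exact hanti _ _
  let φ : (it N).range →* (it N).range :=
    ((it N).comp (it N).range.subtype).codRestrict _ (fun x => ⟨x, rfl⟩)
  have hφs : Function.Surjective φ := by
    rintro ⟨y, hy⟩
    have hy' := hy
    rw [hNN] at hy'
    obtain ⟨x, hx⟩ := hy'
    refine ⟨⟨it N x, x, rfl⟩, Subtype.ext ?_⟩
    change it N (it N x) = y
    rw [← hadd, hx]
  have hφi := hopf_of_nuRank (fg_range' fg_freeGroup _) φ hφs le_rfl
  let e := MulEquiv.ofBijective φ ⟨hφi, hφs⟩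
  let ρ : FreeGroup α →* FreeGroup α :=
    (it N).range.subtype.comp (e.symm.toMonoidHom.comp (it N).rangeRestrict)
  have hρ : ∀ x, it N (ρ x) = it N x := by
    intro x
    have : e (e.symm ((it N).rangeRestrict x)) = (it N).rangeRestrict x := e.apply_symm_apply _
    exact congrArg Subtype.val this
  have hid := hR ρ (by
      intro x
      have : (it N).rangeRestrict (ρ x) = (it N).rangeRestrict x := Subtype.ext (hρ x)
      change ((e.symm ((it N).rangeRestrict (ρ x)) : (it N).range) : FreeGroup α) = _
      rw [this]; rfl)
    (by
      intro x hx
      have h1 : (it N).rangeRestrict x = e ⟨x, x, hfix _ x hx⟩ := Subtype.ext rfl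
      change ((e.symm ((it N).rangeRestrict x) : (it N).range) : FreeGroup α) = _
      rw [h1, e.symm_apply_apply])
  intro x
  have h1 : x ∈ (it N).range := by
    rw [← hid x]
    exact (e.symm ((it N).rangeRestrict x)).2
  obtain ⟨y, hy⟩ := h1
  refine ⟨it (N - 1) y, ?_⟩
  rw [← hone, ← hadd, Nat.add_sub_cancel' hN, hy]

lemma turner {α : Type} [Finite α] (E0 : Set (FreeGroup α)) (hE : E0.Finite) (hR : Rigid E0)
    (θ : FreeGroup α →* FreeGroup α) (hθ : ∀ e ∈ E0, θ e = e) : Function.Bijective θ := by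
  let T := {θ : FreeGroup α →* FreeGroup α // ∀ e ∈ E0, θ e = e}
  haveI : Nonempty T := ⟨⟨MonoidHom.id _, fun _ _ => rfl⟩⟩
  let ν : T → ℕ := fun θ => nuRank θ.1.range
  let θ0 := Function.argmin ν
  have h0 : ∀ θ' : T, ν θ0 ≤ ν θ' := fun θ' => Function.argmin_le ν θ'
  have hs0 := turner_T1 E0 hE hR θ0.1 θ0.2 (fun θ' h => h0 ⟨θ', h⟩)
  have hs : Function.Surjective θ := by
    refine turner_T1 E0 hE hR θ hθ (fun θ' h => ?_)
    calc nuRank θ.range ≤ nuRank (FreeGroup α) :=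
          nuRank_le_of_surjective fg_freeGroup θ.rangeRestrict θ.rangeRestrict_surjective
      _ ≤ nuRank θ0.1.range := by
          exact nuRank_le_of_surjective (fg_range' fg_freeGroup _) θ0.1.range.subtype
            (fun x => ⟨⟨x, hs0 x⟩, rfl⟩)
      _ ≤ _ := h0 ⟨θ', h⟩
  exact ⟨freeGroup_hopf θ hs, hs⟩

end Part3


section Part4

def lbar {α : Type} (a : α × Bool) : α × Bool := (a.1, !a.2)

lemma lbar_lbar {α : Type} (a : α × Bool) : lbar (lbar a) = a := by
  cases a; simp [lbar]

lemma lbar_ne {α : Type} (a : α × Bool) : lbar a ≠ a := by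
  rcases a with ⟨x, b⟩
  cases b <;> simp [lbar]

lemma mk_lbar {α : Type} (a : α × Bool) :
    FreeGroup.mk [lbar a] = (FreeGroup.mk [a])⁻¹ := by
  simp [lbar, FreeGroup.invRev]

lemma red_rel {α : Type} (a b : α × Bool) : (a.1 = b.1 → a.2 = b.2) ↔ b ≠ lbar a := by
  rcases a with ⟨x, s⟩
  rcases b with ⟨y, t⟩
  simp only [lbar, ne_eq, Prod.mk.injEq, not_and]
  constructor
  · intro h h1 h2
    have := h h1.symm
    subst this
    cases s <;> simp at h2
  · intro h h1
    have := h h1.symm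
    cases s <;> cases t <;> simp_all

lemma isReduced_cons {α : Type} (a : α × Bool) (L : List (α × Bool)) :
    FreeGroup.IsReduced (a :: L) ↔ L.head? ≠ some (lbar a) ∧ FreeGroup.IsReduced L := by
  unfold FreeGroup.IsReduced
  rw [List.isChain_cons]
  refine and_congr_left (fun _ => ?_)
  constructor
  · intro h h'
    exact (red_rel _ _).1 (h _ h') rfl
  · intro h y hy
    rw [red_rel]
    rintro rfl
    exact h hy

def Turns {α : Type} (Q : Option (α × Bool) → Option (α × Bool) → Prop) :
    Option (α × Bool) → List (α × Bool) → Prop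
  | a, [] => Q a none
  | a, b :: W => Q a (some b) ∧ Turns Q (some (lbar b)) W

lemma Turns.imp {α : Type} {Q Q' : Option (α × Bool) → Option (α × Bool) → Prop}
    (h : ∀ a b, Q a b → Q' a b) (W : List (α × Bool)) :
    ∀ a, Turns Q a W → Turns Q' a W := by
  induction W with
  | nil => intro a; exact h _ _
  | cons b W ih => intro a ⟨h1, h2⟩; exact ⟨h _ _ h1, ih _ h2⟩

/-- choice of an extremal boundary edge -/
lemma wh_stage1 {α : Type} (C : Set (FreeGroup α)) (hC1 : C.Nonempty)
    (hC2 : C ≠ Set.univ) (hCf : ∀ s, {g | ¬ (g ∈ C ↔ g * s ∈ C)}.Finite) [Finite α] :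
    ∃ (g : FreeGroup α) (a0 : Option (α × Bool)),
      (∀ b, some b ≠ a0 → ∀ W, FreeGroup.IsReduced (b :: W) →
        (g * FreeGroup.mk (b :: W) ∈ C ↔ g * FreeGroup.mk [b] ∈ C)) ∧
      ∃ b, some b ≠ a0 ∧ ¬ (g ∈ C ↔ g * FreeGroup.mk [b] ∈ C) := by
  classical
  let Bd : Set (List (α × Bool)) := {L | FreeGroup.IsReduced L ∧ ∃ b,
    FreeGroup.IsReduced (L ++ [b]) ∧ ¬ (FreeGroup.mk L ∈ C ↔ FreeGroup.mk (L ++ [b]) ∈ C)}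
  have hfin : Bd.Finite := by
    have h1 : (⋃ b : α × Bool, {g | ¬ (g ∈ C ↔ g * FreeGroup.mk [b] ∈ C)}).Finite :=
      Set.finite_iUnion (fun b => hCf _)
    refine (h1.image FreeGroup.toWord).subset ?_
    rintro L ⟨hL, b, _, hb⟩
    refine ⟨FreeGroup.mk L, Set.mem_iUnion.2 ⟨b, ?_⟩, ?_⟩
    · rw [Set.mem_ofPred_eq, FreeGroup.mul_mk]; exact hb
    · rw [FreeGroup.toWord_mk, hL.reduce_eq]
  have hne : Bd.Nonempty := by
    by_contra hcon
    rw [Set.not_nonempty_iff_eq_empty] at hcon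
    have hinv : ∀ L : List (α × Bool), FreeGroup.IsReduced L → (FreeGroup.mk L ∈ C ↔ (1 : FreeGroup α) ∈ C) := by
      intro L
      induction L using List.reverseRecOn with
      | nil => intro _; rfl
      | append_singleton L b ih =>
        intro h
        have hL : FreeGroup.IsReduced L := h.infix (List.infix_append' [] L [b])
        rw [← ih hL]
        by_contra hn
        have : L ∈ Bd := ⟨hL, b, h, fun h' => hn h'.symm⟩
        rw [hcon] at this
        exact this
    have hinv' : ∀ x, x ∈ C ↔ (1 : FreeGroup α) ∈ C := by
      intro x
      have := hinv x.toWord FreeGroup.isReduced_toWord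
      rwa [FreeGroup.mk_toWord] at this
    obtain ⟨x, hx⟩ := hC1
    exact hC2 (Set.eq_univ_of_forall fun y => (hinv' y).2 ((hinv' x).1 hx))
  obtain ⟨L, ⟨hL, b, hb, hbC⟩, hmax⟩ := Set.exists_max_image Bd List.length hfin hne
  have happ : ∀ (c : α × Bool), L.getLast?.map lbar ≠ some c → ∀ W, FreeGroup.IsReduced (c :: W) →
      FreeGroup.IsReduced (L ++ c :: W) := by
    intro c hc W hW
    unfold FreeGroup.IsReduced at *
    rw [List.isChain_append]
    refine ⟨hL, hW, ?_⟩
    intro x hx y hy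
    rw [red_rel]
    rintro rfl
    apply hc
    simp only [List.head?_cons, Option.mem_def, Option.some.injEq] at hy hx
    rw [hx, hy]; rfl
  refine ⟨FreeGroup.mk L, L.getLast?.map lbar, ?_, b, ?_, ?_⟩
  · intro c hc W
    rw [FreeGroup.mul_mk, FreeGroup.mul_mk]
    induction W using List.reverseRecOn with
    | nil => intro _; rfl
    | append_singleton W d ih =>
      intro h
      have hW : FreeGroup.IsReduced (c :: W) := h.infix ⟨[], [d], by simp⟩
      rw [← ih hW]
      by_contra hn
      have h1 := happ c hc.symm W hW
      have h2 := happ c hc.symm (W ++ [d]) h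
      have : L ++ c :: W ∈ Bd := ⟨h1, d, by simpa using h2, fun h' => hn (by simpa using h'.symm)⟩
      have := hmax _ this
      simp at this
  · intro h
    unfold FreeGroup.IsReduced at hb
    rw [List.isChain_append] at hb
    obtain ⟨c, hc, hcb⟩ := Option.map_eq_some_iff.1 h.symm
    exact (red_rel _ _).1 (hb.2.2 c hc b rfl) hcb.symm
  · rw [FreeGroup.mul_mk]; exact hbC

/-- Either all elements are trivial or we get a set of directions. -/
lemma wh_stage2 {α : Type} [DecidableEq α] (E0 : Set (FreeGroup α)) (C : Set (FreeGroup α))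
    (hC1 : C.Nonempty)
    (hC2 : C ≠ Set.univ) (hCf : ∀ s, {g | ¬ (g ∈ C ↔ g * s ∈ C)}.Finite) [Finite α]
    (hCE : ∀ e ∈ E0, ∀ g, g ∈ C ↔ g * e ∈ C) :
    (Nonempty α ∧ ∀ e ∈ E0, e = 1) ∨ ∃ (v : α × Bool) (P : Set (Option (α × Bool))),
      none ∉ P ∧ some v ∉ P ∧ (∃ b, some b ∈ P) ∧
      ∀ e ∈ E0, Turns (fun a b => a = some v ∨ b = some v ∨ (a ∈ P ↔ b ∈ P)) none e.toWord := by
  obtain ⟨g, a0, h1, b0, hb0, hb0C⟩ := wh_stage1 C hC1 hC2 hCf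
  let P : Set (Option (α × Bool)) :=
    {a | ∃ b, a = some b ∧ some b ≠ a0 ∧ ¬ (g ∈ C ↔ g * FreeGroup.mk [b] ∈ C)}
  have hPn : none ∉ P := by rintro ⟨b, hb, _⟩; cases hb
  have hPb : some b0 ∈ P := ⟨b0, rfl, hb0, hb0C⟩
  -- membership in terms of the first letter
  have key : ∀ W, FreeGroup.IsReduced W → (W.head? ≠ a0 ∨ W = []) →
      ((g * FreeGroup.mk W ∈ C ↔ g ∈ C) ↔ W.head? ∉ P) := by
    intro W hW h
    cases W with
    | nil =>
      simp only [List.head?_nil, hPn, not_false_eq_true, iff_true]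
      rw [← FreeGroup.one_eq_mk, mul_one]
    | cons b W =>
      have hb : some b ≠ a0 := by simpa using h
      rw [h1 b hb W hW]
      simp only [List.head?_cons]
      constructor
      · rintro h2 ⟨b', hb', _, h3⟩
        cases hb'
        exact h3 h2.symm
      · intro h2
        by_contra h3
        exact h2 ⟨b, rfl, hb, fun h4 => h3 h4.symm⟩
  have key2 : ∀ R W : List (α × Bool), FreeGroup.IsReduced R → FreeGroup.IsReduced W →
      (W.head? ≠ a0 ∨ W = []) → (R.head? ≠ a0 ∨ R = []) →
      (∀ x, x ∈ C ↔ x * ((FreeGroup.mk R)⁻¹ * FreeGroup.mk W) ∈ C) →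
      (R.head? ∈ P ↔ W.head? ∈ P) := by
    intro R W hR hW h2 h3 h4
    have h5 := h4 (g * FreeGroup.mk R)
    rw [mul_assoc, mul_inv_cancel_left] at h5
    have k1 := key R hR h3
    have k2 := key W hW h2
    rw [h5] at k1
    exact not_iff_not.1 (k1.symm.trans k2)
  have key3 : ∀ (v : α × Bool), (a0 = none ∨ a0 = some v) → ∀ W R : List (α × Bool),
      FreeGroup.IsReduced R → FreeGroup.IsReduced W →
      (∀ b, R.head? = some b → W.head? ≠ some b) →
      (∀ x, x ∈ C ↔ x * ((FreeGroup.mk R)⁻¹ * FreeGroup.mk W) ∈ C) →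
      Turns (fun a b => a = some v ∨ b = some v ∨ (a ∈ P ↔ b ∈ P)) R.head? W := by
    intro v hv W
    have hd : ∀ W : List (α × Bool), W.head? = some v ∨ (W.head? ≠ a0 ∨ W = []) := by
      intro W
      cases W with
      | nil => simp
      | cons b W =>
        rcases hv with hv | hv
        · simp [hv]
        · simp only [List.head?_cons, hv, reduceCtorEq, or_false]; exact em _
    induction W with
    | nil =>
      intro R hR hW h2 h3
      rcases hd R with h4 | h4
      · exact Or.inl h4
      · exact Or.inr (Or.inr (key2 R [] hR hW (Or.inr rfl) h4 h3))
    | cons b W ih =>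
      intro R hR hW h2 h3
      refine ⟨?_, ?_⟩
      · rcases hd R with h4 | h4
        · exact Or.inl h4
        · rcases hd (b :: W) with h5 | h5
          · exact Or.inr (Or.inl h5)
          · exact Or.inr (Or.inr (key2 R (b :: W) hR hW h5 h4 h3))
      · refine ih (lbar b :: R) ?_ ((isReduced_cons _ _).1 hW).2 ?_ ?_
        · rw [isReduced_cons, lbar_lbar]
          exact ⟨fun h => h2 b h rfl, hR⟩
        · intro c hc
          simp only [List.head?_cons, Option.some.injEq] at hc
          subst hc
          exact ((isReduced_cons _ _).1 hW).1
        · intro x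
          rw [h3 x, mk_cons_eq b W, mk_cons_eq (lbar b) R, mk_lbar, mul_inv_rev, inv_inv, mul_assoc (FreeGroup.mk R)⁻¹]
  have key4 : ∀ (v : α × Bool), (a0 = none ∨ a0 = some v) → ∀ e ∈ E0,
      Turns (fun a b => a = some v ∨ b = some v ∨ (a ∈ P ↔ b ∈ P)) none e.toWord := by
    intro v hv e he
    refine key3 v hv e.toWord [] FreeGroup.IsReduced.nil FreeGroup.isReduced_toWord ?_ ?_
    · intro b hb; cases hb
    · intro x
      rw [hCE e he x, FreeGroup.mk_toWord, ← FreeGroup.one_eq_mk, inv_one, one_mul]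
  by_cases hv : ∃ v, (a0 = none ∨ a0 = some v) ∧ some v ∉ P
  · obtain ⟨v, hv, hvP⟩ := hv
    exact Or.inr ⟨v, P, hPn, hvP, ⟨b0, hPb⟩, key4 v hv⟩
  · left
    refine ⟨⟨b0.1⟩, ?_⟩
    have ha0 : a0 = none := by
      cases ha : a0 with
      | none => rfl
      | some v =>
        exact absurd ⟨v, Or.inr ha, by rintro ⟨b, hb, hb', _⟩; cases hb; exact hb' ha.symm⟩ hv
    intro e he
    have := key e.toWord FreeGroup.isReduced_toWord (by
      rw [ha0]; cases e.toWord <;> simp)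
    rw [FreeGroup.mk_toWord] at this
    have h2 := this.1 (hCE e he g).symm
    cases hw : e.toWord with
    | nil => exact FreeGroup.toWord_eq_nil_iff.1 hw
    | cons b W =>
      rw [hw] at h2
      exact absurd ⟨b, Or.inl ha0, h2⟩ hv

end Part4


section Part4b

open Classical in
noncomputable def whT {α : Type} (Z : Set (Option (α × Bool))) (y : FreeGroup α)
    (a : Option (α × Bool)) : FreeGroup α := if a ∈ Z then y else 1

noncomputable def whPsi {α : Type} (Z : Set (Option (α × Bool))) (y : FreeGroup α) :
    FreeGroup α →* FreeGroup α :=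
  FreeGroup.lift (fun x => whT Z y (some (x, true)) * FreeGroup.of x *
    (whT Z y (some (x, false)))⁻¹)

lemma whPsi_letter {α : Type} (Z : Set (Option (α × Bool))) (y : FreeGroup α) (b : α × Bool) :
    whPsi Z y (FreeGroup.mk [b]) =
      whT Z y (some b) * FreeGroup.mk [b] * (whT Z y (some (lbar b)))⁻¹ := by
  have h : ∀ x, whPsi Z y (FreeGroup.of x) = whT Z y (some (x, true)) * FreeGroup.of x *
    (whT Z y (some (x, false)))⁻¹ := fun x => by simp [whPsi]
  rcases b with ⟨x, _ | _⟩
  · rw [mk_false_eq, map_inv, h]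
    simp only [lbar, Bool.not_false]
    group
  · exact h x

lemma whT_eq {α : Type} {Z : Set (Option (α × Bool))} {y : FreeGroup α}
    {a b : Option (α × Bool)} (h : a ∈ Z ↔ b ∈ Z) : whT Z y a = whT Z y b := by
  unfold whT
  by_cases ha : a ∈ Z
  · rw [if_pos ha, if_pos (h.1 ha)]
  · rw [if_neg ha, if_neg (fun hb => ha (h.2 hb))]

lemma whPsi_fix {α : Type} (Z : Set (Option (α × Bool))) (hZ : none ∉ Z) (y : FreeGroup α)
    (W : List (α × Bool)) : ∀ a, Turns (fun a b => a ∈ Z ↔ b ∈ Z) a W →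
      (whT Z y a)⁻¹ * whPsi Z y (FreeGroup.mk W) = FreeGroup.mk W := by
  induction W with
  | nil =>
    intro a h
    rw [whT_eq h, ← FreeGroup.one_eq_mk, map_one]
    simp [whT, hZ]
  | cons b W ih =>
    rintro a ⟨h1, h2⟩
    rw [mk_cons_eq, map_mul, whPsi_letter, whT_eq h1]
    have := ih _ h2
    rw [mul_assoc, mul_assoc, inv_mul_cancel_left, this]

def WhOK {α : Type} (Z : Set (Option (α × Bool))) (y : FreeGroup α) (v : α × Bool)
    (a b : Option (α × Bool)) : Prop :=
  (a ∈ Z ↔ b ∈ Z) ∨ (a = some v ∧ (whT Z y a)⁻¹ * whT Z y b = FreeGroup.mk [v]) ∨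
    (b = some v ∧ (whT Z y a)⁻¹ * whT Z y b = (FreeGroup.mk [v])⁻¹)

open Classical in
noncomputable def whNt {α : Type} (Z : Set (Option (α × Bool))) :
    Option (α × Bool) → List (α × Bool) → ℕ
  | a, [] => if (a ∈ Z ↔ none ∈ Z) then 0 else 1
  | a, b :: W => (if (a ∈ Z ↔ some b ∈ Z) then 0 else 1) + whNt Z (some (lbar b)) W

lemma whNt_zero {α : Type} (Z : Set (Option (α × Bool))) (W : List (α × Bool)) :
    ∀ a, whNt Z a W = 0 → Turns (fun a b => a ∈ Z ↔ b ∈ Z) a W := by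
  induction W with
  | nil => intro a h; simpa [whNt, Turns] using h
  | cons b W ih =>
    intro a h
    simp only [whNt, Nat.add_eq_zero_iff] at h
    refine ⟨?_, ih _ h.2⟩
    by_contra hn
    rw [if_neg hn] at h
    exact one_ne_zero h.1

lemma norm_letter_le {α : Type} [DecidableEq α] (b : α × Bool) :
    (FreeGroup.mk [b]).norm ≤ 1 := FreeGroup.norm_mk_le

open Classical in
lemma wh_length {α : Type} [DecidableEq α] (Z : Set (Option (α × Bool))) (hZ : none ∉ Z)
    (y : FreeGroup α) (v : α × Bool) (W : List (α × Bool)) :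
    ∀ a, Turns (WhOK Z y v) a W →
      ((if a = some v then (FreeGroup.mk [v])⁻¹ else 1) *
        ((whT Z y a)⁻¹ * whPsi Z y (FreeGroup.mk W))).norm + whNt Z a W ≤
        W.length + (if a = some v then 1 else 0) := by
  have hpre : ∀ a : Option (α × Bool), 
      (if a = some v then (FreeGroup.mk [v])⁻¹ else 1 : FreeGroup α).norm ≤
        (if a = some v then 1 else 0) := by
    intro a
    split_ifs
    · rw [FreeGroup.norm_inv_eq]; exact norm_letter_le v
    · simp
  induction W with
  | nil =>
    intro a h
    rw [← FreeGroup.one_eq_mk, map_one, mul_one]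
    have hn : whT Z y none = 1 := by simp [whT, hZ]
    rcases h with h | ⟨h1, h2⟩ | ⟨h1, h2⟩
    · rw [whT_eq h, hn]
      have := hpre a
      simp only [whNt, if_pos h]
      simpa using this
    · rw [hn, mul_one] at h2
      rw [h2]
      subst h1
      simp only [if_pos, inv_mul_cancel, FreeGroup.norm_one, whNt]
      split_ifs <;> simp
    · cases h1
  | cons b W ih =>
    rintro a ⟨h1, h2⟩
    have IH := ih _ h2
    rw [mk_cons_eq b W, map_mul, whPsi_letter]
    set F : FreeGroup α := (whT Z y (some (lbar b)))⁻¹ * whPsi Z y (FreeGroup.mk W) with hF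
    set nt := whNt Z (some (lbar b)) W
    have e1 : (whT Z y a)⁻¹ * (whT Z y (some b) * FreeGroup.mk [b] *
        (whT Z y (some (lbar b)))⁻¹ * whPsi Z y (FreeGroup.mk W)) =
        ((whT Z y a)⁻¹ * whT Z y (some b)) * (FreeGroup.mk [b] * F) := by
      rw [hF]; group
    rw [e1]
    have hb1 : (FreeGroup.mk [b] * F).norm + nt ≤ W.length + 1 := by
      by_cases hbv : lbar b = v
      · have : FreeGroup.mk [b] = (FreeGroup.mk [v])⁻¹ := by
          rw [← hbv, mk_lbar, inv_inv]
        rw [this]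
        simpa [hbv] using IH
      · have h3 : F.norm + nt ≤ W.length := by simpa [hbv] using IH
        have := FreeGroup.norm_mul_le (FreeGroup.mk [b]) F
        have := norm_letter_le b
        omega
    have hp := hpre a
    set pre : FreeGroup α := if a = some v then (FreeGroup.mk [v])⁻¹ else 1 with hpredef
    simp only [whNt, List.length_cons]
    have hite : (if (a ∈ Z ↔ some b ∈ Z) then 0 else 1) ≤ 1 := by split_ifs <;> simp
    rcases h1 with h | ⟨h3, h4⟩ | ⟨h3, h4⟩
    · rw [whT_eq h, inv_mul_cancel, one_mul, if_pos h]
      have := FreeGroup.norm_mul_le pre (FreeGroup.mk [b] * F)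
      omega
    · rw [h4, hpredef, if_pos h3, if_pos h3, inv_mul_cancel_left]
      omega
    · rw [h4]
      have hbv : b = v := by simpa using h3
      have hbv' : ¬ lbar b = v := by rw [hbv]; exact lbar_ne v
      have h5 : F.norm + nt ≤ W.length := by simpa [hbv'] using IH
      have hbv2 : FreeGroup.mk [b] = FreeGroup.mk [v] := by rw [hbv]
      rw [hbv2, inv_mul_cancel_left]
      have := FreeGroup.norm_mul_le pre F
      omega

lemma wh_length' {α : Type} [DecidableEq α] (Z : Set (Option (α × Bool))) (hZ : none ∉ Z)
    (y : FreeGroup α) (v : α × Bool) (e : FreeGroup α) (h : Turns (WhOK Z y v) none e.toWord) :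
    (whPsi Z y e).norm + whNt Z none e.toWord ≤ e.norm := by
  have := wh_length Z hZ y v e.toWord none h
  rw [FreeGroup.mk_toWord] at this
  simpa [whT, hZ, FreeGroup.norm] using this

lemma wh_comp {α : Type} (Z : Set (Option (α × Bool))) (y z : FreeGroup α)
    (h : whPsi Z z y = y) (hz : z = y⁻¹) (x : FreeGroup α) : whPsi Z z (whPsi Z y x) = x := by
  have : (whPsi Z z).comp (whPsi Z y) = MonoidHom.id _ := by
    have ht : ∀ a, whPsi Z z (whT Z y a) * whT Z z a = 1 := by
      intro a
      unfold whT
      split_ifs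
      · rw [h, hz, mul_inv_cancel]
      · simp
    apply FreeGroup.ext_hom
    intro x
    have h1 := whPsi_letter Z y (x, true)
    have h2 := whPsi_letter Z z (x, true)
    change whPsi Z y (FreeGroup.of x) = _ * FreeGroup.of x * _ at h1
    change whPsi Z z (FreeGroup.of x) = _ * FreeGroup.of x * _ at h2
    rw [MonoidHom.comp_apply, h1, map_mul, map_mul, h2, map_inv]
    rw [MonoidHom.id_apply]
    have k1 := ht (some (x, true))
    have k2 := ht (some (lbar (x, true)))
    rw [mul_eq_one_iff_eq_inv] at k1 k2
    rw [k1, k2]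
    group
  exact DFunLike.congr_fun this x

/-- the terminal case -/
lemma wh_final {α : Type} [DecidableEq α] (E0 : Set (FreeGroup α)) (Z : Set (Option (α × Bool)))
    (hZ : none ∉ Z) (hb : ∃ b, some b ∈ Z)
    (hT : ∀ e ∈ E0, Turns (fun a b => a ∈ Z ↔ b ∈ Z) none e.toWord) : ¬ Rigid E0 := by
  classical
  intro hR
  have hne1 : ∀ b : α × Bool, FreeGroup.mk [b] ≠ 1 := by
    intro b h
    have := congrArg FreeGroup.toWord h
    simp [FreeGroup.toWord_mk] at this
  by_cases hc : ∃ b, some b ∈ Z ∧ some (lbar b) ∉ Z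
  · obtain ⟨b, hb1, hb2⟩ := hc
    let y : FreeGroup α := (FreeGroup.mk [b])⁻¹
    have hρb : whPsi Z y (FreeGroup.mk [b]) = 1 := by
      rw [whPsi_letter]; simp only [whT, if_pos hb1, if_neg hb2, y]; group
    have ht : ∀ a, whPsi Z y (whT Z y a) = 1 := by
      intro a
      unfold whT
      split_ifs
      · simp only [y, map_inv]
        have := hρb
        simp only [y] at this
        rw [this, inv_one]
      · simp
    have hid : (whPsi Z y).comp (whPsi Z y) = whPsi Z y := by
      apply FreeGroup.ext_hom
      intro x
      have h1 := whPsi_letter Z y (x, true)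
      change whPsi Z y (FreeGroup.of x) = _ * FreeGroup.of x * _ at h1
      rw [MonoidHom.comp_apply]
      conv_lhs => rw [h1]
      rw [map_mul, map_mul, map_inv, ht, ht]
      simp
    have := hR (whPsi Z y) (fun x => DFunLike.congr_fun hid x) (by
      intro e he
      have := whPsi_fix Z hZ y e.toWord none (hT e he)
      rw [FreeGroup.mk_toWord] at this
      simpa [whT, hZ] using this) (FreeGroup.mk [b])
    exact hne1 b (this.symm.trans hρb)
  · push Not at hc
    have hsym : ∀ b, some (lbar b) ∈ Z ↔ some b ∈ Z := by
      intro b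
      refine ⟨fun h => ?_, hc b⟩
      have := hc _ h
      rwa [lbar_lbar] at this
    let ρ : FreeGroup α →* FreeGroup α :=
      FreeGroup.lift (fun x => if some (x, true) ∈ Z then 1 else FreeGroup.of x)
    have hρo : ∀ x, ρ (FreeGroup.of x) = if some (x, true) ∈ Z then 1 else FreeGroup.of x := by
      intro x; simp [ρ]
    have hρ : ∀ b, ρ (FreeGroup.mk [b]) = if some b ∈ Z then 1 else FreeGroup.mk [b] := by
      rintro ⟨x, _ | _⟩
      · have := hsym (x, true)
        simp only [lbar, Bool.not_true] at this
        rw [mk_false_eq, map_inv, hρo]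
        simp only [this]
        split_ifs <;> simp
      · exact hρo x
    have hid : ρ.comp ρ = ρ := by
      apply FreeGroup.ext_hom
      intro x
      rw [MonoidHom.comp_apply, hρo]
      split_ifs with h
      · simp
      · rw [hρo, if_neg h]
    have hfix : ∀ W a, a ∉ Z → Turns (fun a b => a ∈ Z ↔ b ∈ Z) a W →
        ρ (FreeGroup.mk W) = FreeGroup.mk W := by
      intro W
      induction W with
      | nil => intro a _ _; rw [← FreeGroup.one_eq_mk, map_one]
      | cons b W ih =>
        rintro a ha ⟨h1, h2⟩
        have hbZ : some b ∉ Z := fun h => ha (h1.2 h)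
        rw [mk_cons_eq, map_mul, hρ, if_neg hbZ, ih _ (fun h => hbZ ((hsym b).1 h)) h2]
    obtain ⟨b, hb⟩ := hb
    have := hR ρ (fun x => DFunLike.congr_fun hid x) (by
      intro e he
      have := hfix e.toWord none hZ (hT e he)
      rwa [FreeGroup.mk_toWord] at this) (FreeGroup.mk [b])
    rw [hρ, if_pos hb] at this
    exact hne1 b this.symm

/-- choice of the Whitehead automorphism -/
lemma wh_choice {α : Type} [DecidableEq α] (v : α × Bool) (P : Set (Option (α × Bool)))
    (hn : none ∉ P) (hv : some v ∉ P) (hb : ∃ b, some b ∈ P) :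
    ∃ (Z : Set (Option (α × Bool))) (y : FreeGroup α), none ∉ Z ∧ (∃ b, some b ∈ Z) ∧
      whPsi Z y⁻¹ y = y ∧ whPsi Z y y = y ∧
      ∀ a b, (a = some v ∨ b = some v ∨ (a ∈ P ↔ b ∈ P)) → WhOK Z y v a b := by
  by_cases h : some (lbar v) ∈ P
  · refine ⟨P ∪ {some v}, (FreeGroup.mk [v])⁻¹, by simp [hn], ?_, ?_, ?_, ?_⟩
    · obtain ⟨b, hb⟩ := hb
      exact ⟨b, Or.inl hb⟩
    · have h1 : some v ∈ P ∪ {some v} := Or.inr rfl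
      have h2 : some (lbar v) ∈ P ∪ {some v} := Or.inl h
      rw [map_inv, whPsi_letter]; simp only [whT, if_pos h1, if_pos h2]; group
    · have h1 : some v ∈ P ∪ {some v} := Or.inr rfl
      have h2 : some (lbar v) ∈ P ∪ {some v} := Or.inl h
      rw [map_inv, whPsi_letter]; simp only [whT, if_pos h1, if_pos h2]; group
    · intro a b hab
      by_cases ha : a = some v
      · subst ha
        by_cases hb' : b ∈ P ∪ {some v}
        · left; simp only [hb', iff_true]; exact Or.inr rfl
        · right; left; refine ⟨rfl, ?_⟩
          simp only [whT, hb']; simp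
      · by_cases hb' : b = some v
        · subst hb'
          by_cases ha' : a ∈ P ∪ {some v}
          · left; simp only [ha', true_iff]; exact Or.inr rfl
          · right; right; refine ⟨rfl, ?_⟩
            simp only [whT, ha']; simp
        · left
          simp only [Set.mem_union, Set.mem_singleton_iff, ha, hb', or_false]
          tauto
  · refine ⟨P, FreeGroup.mk [v], hn, hb, ?_, ?_, ?_⟩
    · rw [whPsi_letter]; simp [whT, h, hv]
    · rw [whPsi_letter]; simp [whT, h, hv]
    · intro a b hab
      by_cases ha : a = some v
      · subst ha
        by_cases hb' : b ∈ P
        · right; left; refine ⟨rfl, ?_⟩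
          simp [whT, hv, hb']
        · left; tauto
      · by_cases hb' : b = some v
        · subst hb'
          by_cases ha' : a ∈ P
          · right; right; refine ⟨rfl, ?_⟩
            simp [whT, hv, ha']
          · left; tauto
        · left; tauto

lemma whitehead {α : Type} [DecidableEq α] [Finite α] (n : ℕ) :
    ∀ (E0 : Finset (FreeGroup α)), ∑ e ∈ E0, e.norm = n → ∀ (C : Set (FreeGroup α)),
    C.Nonempty → C ≠ Set.univ → (∀ s, {g | ¬ (g ∈ C ↔ g * s ∈ C)}.Finite) →
    (∀ e ∈ E0, ∀ g, g ∈ C ↔ g * e ∈ C) → ¬ Rigid (E0 : Set (FreeGroup α)) := by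
  induction n using Nat.strong_induction_on with
  | _ n IH =>
  intro E0 hn C hC1 hC2 hCf hCE hR
  rcases wh_stage2 (E0 : Set (FreeGroup α)) C hC1 hC2 hCf hCE with ⟨⟨x⟩, h1⟩ | ⟨v, P, h1, h2, h3, h4⟩
  · have := hR 1 (fun _ => rfl) (fun e he => (h1 e he).symm) (FreeGroup.of x)
    exact FreeGroup.of_ne_one x this.symm
  · obtain ⟨Z, y, hZn, hZb, hy1, hy2, hOK⟩ := wh_choice v P h1 h2 h3
    have hlen : ∀ e ∈ E0, (whPsi Z y e).norm + whNt Z none e.toWord ≤ e.norm := by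
      intro e he
      exact wh_length' Z hZn y v e (Turns.imp hOK _ _ (h4 e he))
    by_cases hnt : ∀ e ∈ E0, whNt Z none e.toWord = 0
    · exact wh_final (E0 : Set (FreeGroup α)) Z hZn hZb (fun e he => whNt_zero _ _ _ (hnt e he)) hR
    · push Not at hnt
      obtain ⟨e0, he0, hnt⟩ := hnt
      have hinv1 : ∀ x, whPsi Z y⁻¹ (whPsi Z y x) = x := wh_comp Z y y⁻¹ hy1 rfl
      have hinv2 : ∀ x, whPsi Z y (whPsi Z y⁻¹ x) = x :=
        wh_comp Z y⁻¹ y (by rw [map_inv, hy2]) (inv_inv y).symm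
      have hinj : Function.Injective (whPsi Z y) := Function.LeftInverse.injective hinv1
      have hsum : ∑ e ∈ E0.image (whPsi Z y), e.norm < n := by
        rw [Finset.sum_image (fun a _ b _ h => hinj h), ← hn]
        refine Finset.sum_lt_sum (fun e he => ?_) ⟨e0, he0, ?_⟩
        · have := hlen e he; omega
        · have := hlen e0 he0; omega
      refine IH _ hsum (E0.image (whPsi Z y)) rfl (whPsi Z y⁻¹ ⁻¹' C) ?_ ?_ ?_ ?_ ?_
      · obtain ⟨x, hx⟩ := hC1
        exact ⟨whPsi Z y x, by rw [Set.mem_preimage, hinv1]; exact hx⟩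
      · intro hu
        apply hC2
        apply Set.eq_univ_of_forall
        intro x
        have : whPsi Z y x ∈ whPsi Z y⁻¹ ⁻¹' C := by rw [hu]; trivial
        rwa [Set.mem_preimage, hinv1] at this
      · intro s
        have hi2 : Function.Injective (whPsi Z y⁻¹) := Function.LeftInverse.injective hinv2
        have := (hCf (whPsi Z y⁻¹ s)).preimage (f := whPsi Z y⁻¹) hi2.injOn
        refine this.subset ?_
        intro g hg
        change ¬ (_ ↔ _)
        rw [← map_mul]
        exact hg
      · intro e he g
        obtain ⟨e', he', rfl⟩ := Finset.mem_image.1 he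
        rw [Set.mem_preimage, Set.mem_preimage, map_mul, hinv1]
        exact hCE e' he' _
      · intro ρ hρ1 hρ2 x
        have := hR ((whPsi Z y⁻¹).comp (ρ.comp (whPsi Z y))) (by
          intro x
          simp only [MonoidHom.comp_apply, hinv2, hρ1]) (by
          intro e he
          simp only [MonoidHom.comp_apply]
          rw [hρ2 _ (by simpa using ⟨e, he, rfl⟩), hinv1]) (whPsi Z y⁻¹ x)
        simp only [MonoidHom.comp_apply, hinv2] at this
        have := congrArg (whPsi Z y) this
        rwa [hinv2, hinv2] at this

end Part4b


section Part5

lemma cocycle_ext {X Ω M : Type} [Group M] (τ : FreeGroup X →* Equiv.Perm Ω)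
    (c c' : FreeGroup X → Ω → M)
    (hc : ∀ g g' ω, c (g * g') ω = c g ω * c g' ((τ g)⁻¹ ω))
    (hc' : ∀ g g' ω, c' (g * g') ω = c' g ω * c' g' ((τ g)⁻¹ ω))
    (h : ∀ x ω, c (FreeGroup.of x) ω = c' (FreeGroup.of x) ω) (g : FreeGroup X) :
    ∀ ω, c g ω = c' g ω := by
  induction g using FreeGroup.induction_on with
  | C1 => intro ω; rw [cocycle_one τ c hc, cocycle_one τ c' hc']
  | of x => exact h x
  | inv_of x _ => intro ω; rw [cocycle_inv τ c hc, cocycle_inv τ c' hc', h]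
  | mul x y hx hy => intro ω; rw [hc, hc', hx, hy]

lemma exists_chi {N : Type} [Group N] [IsFreeGroup N] (hN : ∃ k : N, k ≠ 1) :
    ∃ (χ : N →* Multiplicative (ZMod 2)) (k : N), χ k ≠ 1 := by
  let e := IsFreeGroup.toFreeGroup N
  by_cases hX : Nonempty (IsFreeGroup.Generators N)
  · obtain ⟨x⟩ := hX
    let χ0 : FreeGroup (IsFreeGroup.Generators N) →* Multiplicative (ZMod 2) :=
      FreeGroup.lift (fun _ => Multiplicative.ofAdd 1)
    refine ⟨χ0.comp e.toMonoidHom, e.symm (FreeGroup.of x), ?_⟩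
    have : (χ0.comp e.toMonoidHom) (e.symm (FreeGroup.of x)) = Multiplicative.ofAdd 1 := by
      simp [χ0]
    rw [this]
    decide
  · obtain ⟨k, hk⟩ := hN
    rw [not_nonempty_iff] at hX
    exact absurd (e.injective (Subsingleton.elim _ _)) hk

open Classical in
lemma sections_core {Y α : Type} [Finite α] (f : FreeGroup Y →* FreeGroup α)
    (σ1 σ2 : FreeGroup α →* FreeGroup Y) (h1 : ∀ s, f (σ1 s) = s) (h2 : ∀ s, f (σ2 s) = s)
    (htop : σ1.range ⊔ σ2.range = ⊤) (E0 : Finset (FreeGroup α))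
    (hE : ∀ e ∈ E0, σ1 e = σ2 e) (hR : Rigid (E0 : Set (FreeGroup α))) :
    Function.Injective f := by
  let τ : FreeGroup Y →* Equiv.Perm (FreeGroup α) :=
    (MulAction.toPermHom (FreeGroup α) (FreeGroup α)).comp f
  have hτ : ∀ g u, τ g u = f g * u := fun _ _ => rfl
  have hτ' : ∀ g u, (τ g)⁻¹ u = (f g)⁻¹ * u := fun _ _ => rfl
  obtain ⟨n, hn, hna⟩ := exists_cocycle τ
    (fun y u => (Multiplicative.ofAdd (Finsupp.single (y, u) 1) :
      Multiplicative ((Y × FreeGroup α) →₀ ZMod 2)))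
  have hnfin : ∀ (p : Y × FreeGroup α) (g : FreeGroup Y),
      {u | Multiplicative.toAdd (n g u) p ≠ 0}.Finite := by
    intro p g
    induction g using FreeGroup.induction_on with
    | C1 => simp [cocycle_one τ n hn]
    | of y =>
      refine (Set.finite_singleton p.2).subset ?_
      intro u hu
      by_contra hne
      apply hu
      rw [hna, toAdd_ofAdd, Finsupp.single_apply, if_neg]
      rintro rfl
      exact hne rfl
    | inv_of y ih =>
      refine (ih.preimage (f := τ (FreeGroup.of y)) (Equiv.injective _).injOn).subset ?_
      intro u hu
      have hu' : Multiplicative.toAdd (n (FreeGroup.of y)⁻¹ u) p ≠ 0 := hu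
      rw [cocycle_inv τ n hn] at hu'
      change Multiplicative.toAdd (n _ _) p ≠ 0
      simpa using hu'
    | mul g g' h h' =>
      refine (h.union (h'.preimage (f := ⇑(τ g)⁻¹) (Equiv.injective _).injOn)).subset ?_
      intro u hu
      by_contra hcon
      simp only [Set.mem_union, not_or] at hcon
      have e1 : Multiplicative.toAdd (n g u) p = 0 := by
        by_contra hh; exact hcon.1 hh
      have e2 : Multiplicative.toAdd (n g' ((τ g)⁻¹ u)) p = 0 := by
        by_contra hh; exact hcon.2 hh
      apply hu
      rw [hn, toAdd_mul, Finsupp.add_apply, e1, e2, add_zero]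
  -- step 1: the two lifts have the same edge counts
  have hD : ∀ s u, n (σ1 s) u = n (σ2 s) u := by
    by_contra hcon
    push Not at hcon
    obtain ⟨s0, u, hs0⟩ := hcon
    have : ∃ p, Multiplicative.toAdd (n (σ1 s0) u) p ≠ Multiplicative.toAdd (n (σ2 s0) u) p := by
      by_contra hh
      push Not at hh
      exact hs0 (Multiplicative.toAdd.injective (Finsupp.ext hh))
    obtain ⟨p, hp⟩ := this
    let d : FreeGroup α → FreeGroup α → ZMod 2 := fun s u =>
      Multiplicative.toAdd (n (σ1 s) u) p - Multiplicative.toAdd (n (σ2 s) u) p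
    have hd : ∀ s t u, d (s * t) u = d s u + d t (s⁻¹ * u) := by
      intro s t u
      simp only [d, map_mul, hn, hτ', h1, h2, toAdd_mul, Finsupp.add_apply]
      ring
    have hdf : ∀ t, {u | d t u ≠ 0}.Finite := by
      intro t
      refine ((hnfin p (σ1 t)).union (hnfin p (σ2 t))).subset ?_
      intro u hu
      by_contra hcon
      simp only [Set.mem_union, not_or] at hcon
      have e1 : Multiplicative.toAdd (n (σ1 t) u) p = 0 := by
        by_contra hh; exact hcon.1 hh
      have e2 : Multiplicative.toAdd (n (σ2 t) u) p = 0 := by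
        by_contra hh; exact hcon.2 hh
      apply hu
      simp only [d, e1, e2, sub_zero]
    refine whitehead _ E0 rfl {s | d s u ≠ 0} ?_ ?_ ?_ ?_ hR
    · exact ⟨s0, sub_ne_zero.2 hp⟩
    · intro hu
      have : (1 : FreeGroup α) ∈ {s | d s u ≠ 0} := by rw [hu]; trivial
      apply this
      simp [d]
    · intro t
      have hinj : Function.Injective (fun s : FreeGroup α => s⁻¹ * u) := by
        intro a b hab
        simpa using hab
      refine ((hdf t).preimage (f := fun s : FreeGroup α => s⁻¹ * u) hinj.injOn).subset ?_
      intro s hs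
      by_contra hcon
      have e1 : d t (s⁻¹ * u) = 0 := by
        by_contra hh; exact hcon hh
      apply hs
      change d s u ≠ 0 ↔ d (s * t) u ≠ 0
      rw [hd, e1, add_zero]
    · intro e he s
      change d s u ≠ 0 ↔ d (s * e) u ≠ 0
      have : d e (s⁻¹ * u) = 0 := by simp only [d, hE e he, sub_self]
      rw [hd, this, add_zero]
  -- step 2: edge counts only depend on the image
  let T : Subgroup (FreeGroup Y) :=
    { carrier := {g | ∀ u, n g u = n (σ1 (f g)) u}
      one_mem' := by intro u; simp
      mul_mem' := by
        intro a b ha hb u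
        rw [hn, ha, hb, map_mul, map_mul, hn, hτ', hτ', h1]
      inv_mem' := by
        intro a ha u
        rw [cocycle_inv τ n hn, ha, map_inv, map_inv, cocycle_inv τ n hn, hτ, hτ, h1] }
  have hT : T = ⊤ := by
    rw [eq_top_iff, ← htop]
    refine sup_le ?_ ?_
    · rintro _ ⟨s, rfl⟩ u
      rw [h1]
    · rintro _ ⟨s, rfl⟩ u
      rw [h2, hD]
  have hker : ∀ k ∈ f.ker, ∀ u, n k u = 1 := by
    intro k hk u
    have : k ∈ T := by rw [hT]; trivial
    rw [this u, (MonoidHom.mem_ker).1 hk, map_one, cocycle_one τ n hn]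
  -- step 3: the kernel is trivial
  rw [injective_iff_map_eq_one]
  intro k0 hk0
  by_contra hk0'
  obtain ⟨χ, k, hk⟩ := exists_chi (N := f.ker)
    ⟨⟨k0, hk0⟩, fun h => hk0' (congrArg Subtype.val h)⟩
  have hmem : ∀ g u, (σ1 u)⁻¹ * g * σ1 ((f g)⁻¹ * u) ∈ f.ker := by
    intro g u
    rw [MonoidHom.mem_ker]
    simp only [map_mul, map_inv, h1]
    group
  let c : FreeGroup Y → FreeGroup α → Multiplicative (ZMod 2) := fun g u =>
    χ ⟨(σ1 u)⁻¹ * g * σ1 ((f g)⁻¹ * u), hmem g u⟩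
  have hc : ∀ g g' u, c (g * g') u = c g u * c g' ((τ g)⁻¹ u) := by
    intro g g' u
    simp only [c]
    rw [← map_mul]
    congr 1
    apply Subtype.ext
    simp only [hτ', Subgroup.coe_mul, map_mul, mul_inv_rev, map_inv]
    group
  let lam : Multiplicative ((Y × FreeGroup α) →₀ ZMod 2) →* Multiplicative (ZMod 2) :=
    AddMonoidHom.toMultiplicative (Finsupp.liftAddHom (fun p : Y × FreeGroup α =>
      AddMonoidHom.mulRight (Multiplicative.toAdd (c (FreeGroup.of p.1) p.2))))
  have hlam : ∀ g u, lam (n g u) = c g u := by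
    intro g
    refine cocycle_ext τ (fun g u => lam (n g u)) c ?_ hc ?_ g
    · intro g g' u
      simp only [hn, map_mul]
    · intro y u
      rw [hna]
      simp [lam]
  have := hlam k 1
  rw [hker k k.2, map_one] at this
  apply hk
  rw [this]
  simp only [c]
  congr 1
  apply Subtype.ext
  have : f k = 1 := k.2
  simp [this]

lemma sections_eq {K α : Type} [Group K] [IsFreeGroup K] [Finite α] (f : K →* FreeGroup α)
    (σ1 σ2 : FreeGroup α →* K) (h1 : ∀ s, f (σ1 s) = s) (h2 : ∀ s, f (σ2 s) = s)
    (E0 : Set (FreeGroup α)) (hE0 : E0.Finite)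
    (hE : ∀ e ∈ E0, σ1 e = σ2 e) (hR : Rigid E0) (s : FreeGroup α) : σ1 s = σ2 s := by
  let G := σ1.range ⊔ σ2.range
  have hl : σ1.range ≤ G := le_sup_left
  have hr : σ2.range ≤ G := le_sup_right
  let ε : G ≃* FreeGroup (IsFreeGroup.Generators G) := IsFreeGroup.toFreeGroup G
  let f' : FreeGroup (IsFreeGroup.Generators G) →* FreeGroup α :=
    (f.comp G.subtype).comp ε.symm.toMonoidHom
  let s1 : FreeGroup α →* G := σ1.codRestrict G (fun x => hl ⟨x, rfl⟩)
  let s2 : FreeGroup α →* G := σ2.codRestrict G (fun x => hr ⟨x, rfl⟩)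
  have hinj : Function.Injective f' := by
    refine sections_core f' (ε.toMonoidHom.comp s1) (ε.toMonoidHom.comp s2) ?_ ?_ ?_
      hE0.toFinset ?_ (by simpa using hR)
    · intro s; simp [f', s1, h1]
    · intro s; simp [f', s2, h2]
    · rw [MonoidHom.range_comp, MonoidHom.range_comp, ← Subgroup.map_sup]
      have : s1.range ⊔ s2.range = ⊤ := by
        apply Subgroup.map_injective G.subtype_injective
        rw [Subgroup.map_sup, MonoidHom.map_range, MonoidHom.map_range, ← MonoidHom.range_eq_map,
          Subgroup.range_subtype]
        rfl
      rw [this, ← MonoidHom.range_eq_map, MonoidHom.range_eq_top]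
      exact ε.surjective
    · intro e he
      have : s1 e = s2 e := Subtype.ext (hE e (by simpa using he))
      simp [this]
  have : f' (ε (s1 s)) = f' (ε (s2 s)) := by simp [f', s1, s2, h1, h2]
  have := ε.injective (hinj this)
  exact congrArg Subtype.val this

end Part5


section Part6

lemma retract_surj {K : Type} [Group K] {A B : Subgroup K} (hAB : A ≤ B) (hA : IsRetract A) :
    ∃ r : B →* A, Function.Surjective r ∧ ∀ x : B, ∀ h : (x : K) ∈ A, r x = ⟨x, h⟩ := by
  obtain ⟨ρ, h1, h2⟩ := hA
  refine ⟨(ρ.comp B.subtype).codRestrict A (fun x => h1 _), ?_, ?_⟩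
  · rintro ⟨x, hx⟩
    exact ⟨⟨x, hAB hx⟩, Subtype.ext (h2 x hx)⟩
  · rintro x h
    exact Subtype.ext (h2 x h)

lemma retract_nuRank_le {K : Type} [Group K] {A B : Subgroup K} (hAB : A ≤ B) (hA : IsRetract A)
    (hB : Group.FG B) : nuRank A ≤ nuRank B := by
  obtain ⟨r, hr, _⟩ := retract_surj hAB hA
  exact nuRank_le_of_surjective hB r hr

lemma retract_fg {K : Type} [Group K] {A B : Subgroup K} (hAB : A ≤ B) (hA : IsRetract A)
    (hB : Group.FG B) : Group.FG A := by
  obtain ⟨r, hr, _⟩ := retract_surj hAB hA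
  exact Group.fg_of_surjective hr

lemma retract_eq {K : Type} [Group K] [IsFreeGroup K] {A B : Subgroup K} (hAB : A ≤ B)
    (hA : IsRetract A) (hB : Group.FG B) (h : nuRank B ≤ nuRank A) : A = B := by
  obtain ⟨r, hr, hr2⟩ := retract_surj hAB hA
  have hinj := hopf_of_nuRank hB r hr h
  refine le_antisymm hAB (fun x hx => ?_)
  have : r ⟨r ⟨x, hx⟩, hAB (r ⟨x, hx⟩).2⟩ = r ⟨x, hx⟩ := hr2 _ (r ⟨x, hx⟩).2
  have := congrArg Subtype.val (hinj this)
  change ((r ⟨x, hx⟩ : A) : K) = x at this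
  rw [← this]
  exact (r ⟨x, hx⟩).2

lemma bergman_step {K : Type} [Group K] [IsFreeGroup K] (R1 R2 : Subgroup K) (h1 : IsRetract R1)
    (h2 : IsRetract R2) (hfg : Group.FG R1) (E0 : Set K) (hE0 : E0.Finite)
    (hE1 : E0 ⊆ R1) (hE2 : E0 ⊆ R2) :
    ∃ S : Subgroup K, IsRetract S ∧ E0 ⊆ S ∧ S ≤ R1 ∧ S ≤ R2 := by
  let T := {S : Subgroup K // IsRetract S ∧ E0 ⊆ S ∧ S ≤ R1}
  have : Nonempty T := ⟨⟨R1, h1, hE1, le_rfl⟩⟩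
  let ν : T → ℕ := fun S => nuRank S.1
  obtain ⟨⟨S, hS, hES, hSR⟩, hmin⟩ : ∃ S : T, ∀ S', ν S ≤ ν S' :=
    ⟨Function.argmin ν, fun S' => Function.argmin_le ν S'⟩
  have hSfg := retract_fg hSR hS hfg
  obtain ⟨A, hA, ⟨ε⟩, _⟩ := exists_equiv_freeGroup hSfg
  obtain ⟨φ, hφ1, hφ2⟩ := id hS
  let f : K →* S := φ.codRestrict S hφ1
  have hf : ∀ x : S, f x = x := fun x => Subtype.ext (hφ2 x x.2)
  let E' : Set (FreeGroup A) := ε '' {x : S | (x : K) ∈ E0}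
  have hE'f : E'.Finite := (hE0.preimage Subtype.val_injective.injOn).image _
  have hR : Rigid E' := by
    intro ρ hρ1 hρ2
    let r : K →* K := S.subtype.comp (ε.symm.toMonoidHom.comp (ρ.comp (ε.toMonoidHom.comp f)))
    have hrv : ∀ x, r x = ((ε.symm (ρ (ε (f x))) : S) : K) := fun x => rfl
    have hrr : ∀ x, r (r x) = r x := by
      intro x
      rw [hrv (r x), hrv x, hf, ε.apply_symm_apply, hρ1]
    have hle : r.range ≤ S := by
      rintro _ ⟨x, rfl⟩
      exact (ε.symm (ρ (ε (f x))) : S).2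
    have hret : IsRetract r.range := ⟨r, fun x => ⟨x, rfl⟩, by rintro _ ⟨x, rfl⟩; exact hrr x⟩
    have hEr : E0 ⊆ r.range := by
      intro e he
      refine ⟨e, ?_⟩
      have h3 : f e = ⟨e, hES he⟩ := hf ⟨e, hES he⟩
      rw [hrv, h3, hρ2 _ ⟨⟨e, hES he⟩, he, rfl⟩, ε.symm_apply_apply]
    have heq := retract_eq hle hret hSfg (hmin ⟨r.range, hret, hEr, hle.trans hSR⟩)
    intro x
    have hx : ((ε.symm x : S) : K) ∈ r.range := by rw [heq]; exact (ε.symm x).2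
    obtain ⟨z, hz⟩ := hx
    have h3 : r (ε.symm x : S) = (ε.symm x : S) := by rw [← hz, hrr]
    rw [hrv, hf, ε.apply_symm_apply] at h3
    exact ε.symm.injective (Subtype.ext h3)
  obtain ⟨ρ2, hρ1, hρ2⟩ := h2
  let θ : FreeGroup A →* FreeGroup A :=
    ε.toMonoidHom.comp (f.comp (ρ2.comp (S.subtype.comp ε.symm.toMonoidHom)))
  have hθv : ∀ x, θ x = ε (f (ρ2 (ε.symm x : S))) := fun x => rfl
  have hθ : ∀ e ∈ E', θ e = e := by
    rintro _ ⟨e, he, rfl⟩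
    rw [hθv, ε.symm_apply_apply, hρ2 _ (hE2 he), hf]
  have hbij := turner E' hE'f hR θ hθ
  let Θ := MulEquiv.ofBijective θ hbij
  have hΘ : ∀ x, θ (Θ.symm x) = x := fun x => Θ.apply_symm_apply x
  let σ1 : FreeGroup A →* K := S.subtype.comp ε.symm.toMonoidHom
  let σ2 : FreeGroup A →* K :=
    (ρ2.comp (S.subtype.comp ε.symm.toMonoidHom)).comp Θ.symm.toMonoidHom
  have hs := sections_eq (ε.toMonoidHom.comp f) σ1 σ2 (by
      intro s
      change ε (f (ε.symm s : S)) = s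
      rw [hf, ε.apply_symm_apply]) (by
      intro s
      exact hΘ s) E' hE'f (by
      intro e he
      have h3 : Θ.symm e = e := by
        apply hbij.1
        rw [hΘ, hθ e he]
      change ((ε.symm e : S) : K) = ρ2 (ε.symm (Θ.symm e) : S)
      rw [h3]
      obtain ⟨e', he', rfl⟩ := he
      rw [ε.symm_apply_apply, hρ2 _ (hE2 he')]) hR
  refine ⟨S, hS, hES, hSR, ?_⟩
  intro x hx
  have h3 := hs (ε ⟨x, hx⟩)
  have h4 : σ1 (ε ⟨x, hx⟩) = x := by
    change ((ε.symm (ε ⟨x, hx⟩) : S) : K) = x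
    rw [ε.symm_apply_apply]
  rw [h4] at h3
  rw [h3]
  exact hρ1 _

lemma bergman {K : Type} [Group K] [IsFreeGroup K] (R1 R2 : Subgroup K) (h1 : IsRetract R1)
    (h2 : IsRetract R2) (hfg : Group.FG R1) : IsRetract (R1 ⊓ R2) := by
  let T := {S : Subgroup K // IsRetract S ∧ S ≤ R1 ∧ S ≤ R2}
  have hT : Nonempty T := ⟨⟨⊥, ⟨1, fun _ => rfl, fun x hx => (Subgroup.mem_bot.1 hx).symm⟩,
    bot_le, bot_le⟩⟩
  let ν : T → ℕ := fun S => nuRank R1 - nuRank S.1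
  obtain ⟨⟨S, hS, hS1, hS2⟩, hmin⟩ : ∃ S : T, ∀ S', ν S ≤ ν S' :=
    ⟨Function.argmin ν, fun S' => Function.argmin_le ν S'⟩
  have : R1 ⊓ R2 = S := by
    refine le_antisymm ?_ (le_inf hS1 hS2)
    rintro x ⟨hx1, hx2⟩
    have hSfg := retract_fg hS1 hS hfg
    rw [Group.fg_iff_subgroup_fg] at hSfg
    obtain ⟨G, hG⟩ := hSfg
    have hGS : (G : Set K) ⊆ S := by rw [← hG]; exact Subgroup.subset_closure
    obtain ⟨S1, hr, hE, hl1, hl2⟩ := bergman_step R1 R2 h1 h2 hfg (insert x (G : Set K))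
      (G.finite_toSet.insert x)
      (Set.insert_subset hx1 (hGS.trans hS1)) (Set.insert_subset hx2 (hGS.trans hS2))
    have hle : S ≤ S1 := by
      rw [← hG, Subgroup.closure_le]
      exact (Set.subset_insert _ _).trans hE
    have hm := hmin ⟨S1, hr, hl1, hl2⟩
    have hb1 := retract_nuRank_le hl1 hr hfg
    have hb2 := retract_nuRank_le hS1 hS hfg
    simp only [ν] at hm
    have := retract_eq hle hS (retract_fg hl1 hr hfg) (by omega)
    rw [this]
    exact hE (Set.mem_insert _ _)
  rw [this]
  exact hS

end Part6


section Part7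

lemma image_retract {α β : Type} [Finite α] (g : FreeGroup α →* FreeGroup β)
    (hg : Function.Injective g) (K : Subgroup (FreeGroup β)) (hK : g.range ≤ K)
    (hr : IsRetractIn g.range K) (H : Subgroup (FreeGroup α)) (hH : IsRetract H) :
    IsRetract ((H.map g).subgroupOf K) ∧ Group.FG ((H.map g).subgroupOf K) := by
  obtain ⟨r, hr1, hr2⟩ := hr
  obtain ⟨ρ, hρ1, hρ2⟩ := hH
  let gi : FreeGroup α ≃* g.range := MonoidHom.ofInjective hg
  have hgi : ∀ x, ((gi x : g.range) : FreeGroup β) = g x := fun x => rfl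
  let g' : FreeGroup α →* K := g.codRestrict K (fun x => hK ⟨x, rfl⟩)
  constructor
  · refine ⟨g'.comp (ρ.comp (gi.symm.toMonoidHom.comp (r.codRestrict g.range hr1))), ?_, ?_⟩
    · intro x
      rw [Subgroup.mem_subgroupOf]
      exact ⟨_, hρ1 _, rfl⟩
    · rintro ⟨x, hx⟩ ⟨y, hy, hyx⟩
      change g y = x at hyx
      subst hyx
      apply Subtype.ext
      change g (ρ (gi.symm ((r.codRestrict g.range hr1) ⟨g y, hx⟩))) = g y
      have : (r.codRestrict g.range hr1) ⟨g y, hx⟩ = gi y := Subtype.ext (hr2 ⟨g y, hx⟩ ⟨y, rfl⟩)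
      rw [this, gi.symm_apply_apply, hρ2 y hy]
  · have : (H.map g).subgroupOf K = (g'.comp ρ).range := by
      ext x
      rw [Subgroup.mem_subgroupOf]
      constructor
      · rintro ⟨y, hy, hyx⟩
        refine ⟨y, Subtype.ext ?_⟩
        change g (ρ y) = x
        rw [hρ2 y hy, hyx]
      · rintro ⟨y, rfl⟩
        exact ⟨ρ y, hρ1 y, rfl⟩
    rw [this]
    exact fg_range' fg_freeGroup _

lemma chain_retract {α β : Type} [Finite α] (g h : FreeGroup α →* FreeGroup β)
    (hg : Function.Injective g) (hh : Function.Injective h)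
    (hrg : IsRetractIn g.range (g.range ⊔ h.range))
    (hrh : IsRetractIn h.range (g.range ⊔ h.range)) (i : ℕ) : IsRetract (SDChain g h i) := by
  induction i with
  | zero => exact ⟨MonoidHom.id _, fun _ => trivial, fun _ _ => rfl⟩
  | succ i ih =>
    let K := g.range ⊔ h.range
    obtain ⟨h1, h1'⟩ := image_retract g hg K le_sup_left hrg _ ih
    obtain ⟨h2, h2'⟩ := image_retract h hh K le_sup_right hrh _ ih
    obtain ⟨ρ, hρ1, hρ2⟩ := bergman _ _ h1 h2 h1'
    let gi : FreeGroup α ≃* g.range := MonoidHom.ofInjective hg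
    have hgi : ∀ x, ((gi x : g.range) : FreeGroup β) = g x := fun x => rfl
    let g' : FreeGroup α →* K := g.codRestrict K (fun x => (le_sup_left : g.range ≤ K) ⟨x, rfl⟩)
    have hm : ∀ x, (K.subtype.comp (ρ.comp g')) x ∈ g.range := by
      intro x
      obtain ⟨y, _, hy⟩ := (hρ1 (g' x)).1
      exact ⟨y, hy⟩
    let m : FreeGroup α →* FreeGroup α :=
      gi.symm.toMonoidHom.comp ((K.subtype.comp (ρ.comp g')).codRestrict g.range hm)
    have hgm : ∀ x, g (m x) = ρ (g' x) := by
      intro x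
      rw [← hgi]
      change ((gi (gi.symm _) : g.range) : FreeGroup β) = _
      rw [gi.apply_symm_apply]
      rfl
    refine ⟨m, ?_, ?_⟩
    · intro x
      change g (m x) ∈ Subgroup.map g (SDChain g h i) ⊓ Subgroup.map h (SDChain g h i)
      rw [hgm]
      exact hρ1 (g' x)
    · intro x hx
      apply hg
      rw [hgm, hρ2 (g' x) hx]
      rfl

end Part7

/-- if `g, h` are injective, `im g` and `im h` are retracts of
`⟨im g ∪ im h⟩` and `im g ≠ im h`, then each `H_i` (`i ≥ 1`) of the chain defining
`SD(g,h)`, and `SD(g,h)` itself, is a proper retract of `F(Σ)`. -/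
theorem stmt_15 {α β : Type} [Fintype α] (g h : FreeGroup α →* FreeGroup β)
    (hg : Function.Injective g) (hh : Function.Injective h)
    (hrg : IsRetractIn g.range (g.range ⊔ h.range))
    (hrh : IsRetractIn h.range (g.range ⊔ h.range))
    (hne : g.range ≠ h.range) :
    (∀ i : ℕ, 1 ≤ i → IsRetract (SDChain g h i) ∧ SDChain g h i ≠ ⊤) ∧
    (IsRetract (SD g h) ∧ SD g h ≠ ⊤) := by
  have hret := chain_retract g h hg hh hrg hrh
  have hstep : ∀ i, SDChain g h (i + 1) ≤ SDChain g h i := by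
    intro i x hx
    obtain ⟨y, hy, hyx⟩ := hx.1
    rwa [← hg hyx]
  have hanti : Antitone (SDChain g h) := antitone_nat_of_succ_le hstep
  have h1 : SDChain g h 1 ≠ ⊤ := by
    intro htop
    have hle : g.range ≤ h.range := by
      rintro _ ⟨x, rfl⟩
      have hx : x ∈ SDChain g h 1 := by rw [htop]; trivial
      obtain ⟨y, _, hy⟩ := hx.2
      exact ⟨y, hy⟩
    obtain ⟨r, hr1, hr2⟩ := hrg
    have hin : ∀ x, h x ∈ g.range ⊔ h.range := fun x => (le_sup_right : h.range ≤ _) ⟨x, rfl⟩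
    let h' : FreeGroup α →* ↥(g.range ⊔ h.range) := h.codRestrict _ hin
    let gi : FreeGroup α ≃* g.range := MonoidHom.ofInjective hg
    let φ : FreeGroup α →* FreeGroup α :=
      gi.symm.toMonoidHom.comp ((r.codRestrict g.range hr1).comp h')
    have hφ : ∀ x, g (φ x) = r (h' x) := by
      intro x
      change ((gi (gi.symm _) : g.range) : FreeGroup β) = _
      rw [gi.apply_symm_apply]
      rfl
    have hφs : Function.Surjective φ := by
      intro y
      obtain ⟨x, hx⟩ := hle ⟨y, rfl⟩
      refine ⟨x, hg ?_⟩
      rw [hφ, hr2 (h' x) ⟨y, hx.symm⟩]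
      exact hx
    have hφi := freeGroup_hopf φ hφs
    apply hne
    refine le_antisymm hle ?_
    rintro _ ⟨x, rfl⟩
    obtain ⟨y, hy⟩ := hle (hr1 (h' x))
    have : φ y = φ x := by
      apply hg
      rw [hφ, hφ, hr2 (h' y) (by
        change h y ∈ g.range
        rw [hy]; exact hr1 _)]
      exact hy
    rw [← hφi this, hy]
    exact hr1 _
  have hproper : ∀ i, 1 ≤ i → SDChain g h i ≠ ⊤ := by
    intro i hi htop
    exact h1 (top_le_iff.1 (htop ▸ hanti hi))
  refine ⟨fun i hi => ⟨hret i, hproper i hi⟩, ?_, ?_⟩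
  · have hfg : ∀ i, Group.FG (SDChain g h i) := by
      intro i
      have hle : SDChain g h i ≤ ⊤ := le_top
      refine retract_fg hle (hret i) ?_
      rw [Group.fg_iff_subgroup_fg]
      exact Group.fg_def.1 fg_freeGroup
    let ν : ℕ → ℕ := fun i => nuRank (SDChain g h i)
    obtain ⟨i, hmin⟩ : ∃ i, ∀ j, ν i ≤ ν j :=
      ⟨Function.argmin ν, fun j => Function.argmin_le ν j⟩
    have heq : SD g h = SDChain g h i := by
      refine le_antisymm (iInf_le _ i) (le_iInf fun j => ?_)
      rcases le_total j i with hj | hj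
      · exact hanti hj
      · exact (retract_eq (hanti hj) (hret j) (hfg i) (hmin j)).ge
    rw [heq]
    exact hret i
  · intro htop
    exact h1 (top_le_iff.1 (htop ▸ iInf_le _ 1))
end
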